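/- arXiv:1003.5286 — 2 statements merged into one kernel-verified Lean document; each statement's English description precedes it below -/
import Mathlib

section
/- There exists an absolute constant c > 0 such that for every α ∈ (0,1), every function f in the Hölder class Λ_α(ℝ²), and all bounded normal operators N₁, N₂ on a complex Hilbert space H, one has ‖f(N₁) − f(N₂)‖ ≤ c · (1−α)^{-1} · ‖f‖_{Λ_α} · ‖N₁ − N₂‖^α; that is, Hölder functions of order α are operator Hölder of order α on normal operators. -/
section Discrete

open Finset

variable {J K ι : Type*} [NormedAddCommGroup K] [InnerProductSpace ℂ K]
  [CompleteSpace K]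

/-- The image under `M` of the indicator function of the fibre `q ⁻¹' {s}`. -/
noncomputable def fibreProj (M : (J → ℂ) →⋆ₐ[ℂ] (K →L[ℂ] K)) (q : J → ι) (s : ι) : K →L[ℂ] K :=
  M ((q ⁻¹' {s}).indicator 1)

lemma fibreProj_mul_self (M : (J → ℂ) →⋆ₐ[ℂ] (K →L[ℂ] K)) (q : J → ι) (s : ι) :
    fibreProj M q s * fibreProj M q s = fibreProj M q s := by
  rw [fibreProj, ← map_mul]
  congr 1
  ext j
  by_cases h : q j = s <;> simp [h]

lemma adjoint_fibreProj (M : (J → ℂ) →⋆ₐ[ℂ] (K →L[ℂ] K)) (q : J → ι) (s : ι) :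
    ContinuousLinearMap.adjoint (fibreProj M q s) = fibreProj M q s := by
  rw [← ContinuousLinearMap.star_eq_adjoint, fibreProj, ← map_star]
  congr 1
  ext j
  by_cases h : q j = s <;> simp [h]

variable [Fintype J]

lemma norm_map_le (M : (J → ℂ) →⋆ₐ[ℂ] (K →L[ℂ] K)) {g : J → ℂ} {b : ℝ} (hb : 0 ≤ b)
    (hg : ∀ j, ‖g j‖ ≤ b) : ‖M g‖ ≤ b :=
  (NonUnitalStarAlgHom.norm_apply_le M g).trans ((pi_norm_le_iff_of_nonneg hb).2 hg)

lemma norm_fibreProj_le (M : (J → ℂ) →⋆ₐ[ℂ] (K →L[ℂ] K)) (q : J → ι) (s : ι) :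
    ‖fibreProj M q s‖ ≤ 1 :=
  norm_map_le M zero_le_one fun j => by by_cases h : q j = s <;> simp [h]

lemma norm_fibreProj_mul_mul_le (M : (J → ℂ) →⋆ₐ[ℂ] (K →L[ℂ] K)) (q : J → ι) (s t : ι)
    (Y : K →L[ℂ] K) : ‖fibreProj M q s * Y * fibreProj M q t‖ ≤ ‖Y‖ :=
  calc ‖fibreProj M q s * Y * fibreProj M q t‖
      ≤ ‖fibreProj M q s‖ * ‖Y‖ * ‖fibreProj M q t‖ :=
        (norm_mul_le _ _).trans (by gcongr; exact norm_mul_le _ _)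
    _ ≤ 1 * ‖Y‖ * 1 := by gcongr <;> exact norm_fibreProj_le M q _
    _ = ‖Y‖ := by ring

lemma sum_norm_fibreProj_sq_le (M : (J → ℂ) →⋆ₐ[ℂ] (K →L[ℂ] K)) (q : J → ι) (T : Finset ι)
    (x : K) : ∑ s ∈ T, ‖fibreProj M q s x‖ ^ 2 ≤ ‖x‖ ^ 2 := by
  classical
  have h1 : ∀ s, ‖fibreProj M q s x‖ ^ 2 = RCLike.re (inner ℂ x (fibreProj M q s x)) := by
    intro s
    rw [← inner_self_eq_norm_sq (𝕜 := ℂ)]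
    conv_rhs => rw [← fibreProj_mul_self, mul_apply_eq_comp,
      ← ContinuousLinearMap.adjoint_inner_left, adjoint_fibreProj]
  have h2 : ∑ s ∈ T, fibreProj M q s = M (∑ s ∈ T, (q ⁻¹' {s}).indicator 1) := by
    simp [fibreProj]
  have h3 : ‖∑ s ∈ T, fibreProj M q s‖ ≤ 1 := by
    rw [h2]
    refine norm_map_le M zero_le_one fun j => ?_
    simp only [Finset.sum_apply, Set.indicator_apply, Set.mem_preimage, Set.mem_singleton_iff,
      Pi.one_apply, Finset.sum_ite_eq]
    split_ifs <;> simp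
  calc ∑ s ∈ T, ‖fibreProj M q s x‖ ^ 2
      = RCLike.re (inner ℂ x ((∑ s ∈ T, fibreProj M q s) x)) := by
        simp [h1]
    _ ≤ ‖x‖ * ‖(∑ s ∈ T, fibreProj M q s) x‖ := re_inner_le_norm _ _
    _ ≤ ‖x‖ * (1 * ‖x‖) := by
        gcongr
        exact ContinuousLinearMap.le_of_opNorm_le _ h3 x
    _ = ‖x‖ ^ 2 := by ring

/-- A block operator supported on the graph of an injective map has norm at most the supremum of
the norms of its blocks. -/
lemma norm_sum_fibreProj_le (M : (J → ℂ) →⋆ₐ[ℂ] (K →L[ℂ] K)) (q : J → ι) (T : Finset ι)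
    {p : ι → ι} (hp : p.Injective) (Y : ι → K →L[ℂ] K) {b : ℝ} (hb : 0 ≤ b)
    (hY : ∀ s ∈ T, ‖fibreProj M q s * Y s * fibreProj M q (p s)‖ ≤ b) :
    ‖∑ s ∈ T, fibreProj M q s * Y s * fibreProj M q (p s)‖ ≤ b := by
  classical
  refine ContinuousLinearMap.opNorm_le_bound _ hb fun x => ?_
  set v := (∑ s ∈ T, fibreProj M q s * Y s * fibreProj M q (p s)) x with hv
  have key : ‖v‖ ^ 2 ≤ b * ‖x‖ * ‖v‖ := by
    have hterm : ∀ s ∈ T, RCLike.re (inner ℂ v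
        ((fibreProj M q s * Y s * fibreProj M q (p s)) x)) ≤
        b * (‖fibreProj M q (p s) x‖ * ‖fibreProj M q s v‖) := by
      intro s hs
      have e : fibreProj M q s * Y s * fibreProj M q (p s) = fibreProj M q s *
          (fibreProj M q s * Y s * fibreProj M q (p s)) * fibreProj M q (p s) := by
        conv_lhs => rw [← fibreProj_mul_self M q s, ← fibreProj_mul_self M q (p s)]
        noncomm_ring
      rw [e, mul_apply_eq_comp, mul_apply_eq_comp,
        ← ContinuousLinearMap.adjoint_inner_left, adjoint_fibreProj]
      refine (re_inner_le_norm _ _).trans ?_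
      calc _ ≤ ‖fibreProj M q s v‖ * (b * ‖fibreProj M q (p s) x‖) := by
            gcongr
            exact ContinuousLinearMap.le_of_opNorm_le _ (hY s hs) _
        _ = _ := by ring
    calc ‖v‖ ^ 2 = RCLike.re (inner ℂ v v) := (inner_self_eq_norm_sq (𝕜 := ℂ) v).symm
      _ = ∑ s ∈ T, RCLike.re (inner ℂ v ((fibreProj M q s * Y s * fibreProj M q (p s)) x)) := by
        conv_lhs => rw [hv, _root_.sum_apply, inner_sum, map_sum, ← _root_.sum_apply, ← hv]
      _ ≤ ∑ s ∈ T, b * (‖fibreProj M q (p s) x‖ * ‖fibreProj M q s v‖) := sum_le_sum hterm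
      _ = b * ∑ s ∈ T, ‖fibreProj M q (p s) x‖ * ‖fibreProj M q s v‖ := by rw [mul_sum]
      _ ≤ b * (√(∑ s ∈ T, ‖fibreProj M q (p s) x‖ ^ 2) * √(∑ s ∈ T, ‖fibreProj M q s v‖ ^ 2)) := by
        gcongr
        exact Real.sum_mul_le_sqrt_mul_sqrt _ _ _
      _ ≤ b * (√(‖x‖ ^ 2) * √(‖v‖ ^ 2)) := by
        gcongr
        · rw [← Finset.sum_image (f := fun s => ‖fibreProj M q s x‖ ^ 2) hp.injOn]
          exact sum_norm_fibreProj_sq_le M q _ x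
        · exact sum_norm_fibreProj_sq_le M q _ v
      _ = b * ‖x‖ * ‖v‖ := by
        rw [Real.sqrt_sq (norm_nonneg _), Real.sqrt_sq (norm_nonneg _)]; ring
  rcases (norm_nonneg v).eq_or_lt with h | h
  · rw [← h]; positivity
  · nlinarith

/-- The Schur multiplier with symbol `a` applied to `Y`. -/
noncomputable def schurMul (M : (J → ℂ) →⋆ₐ[ℂ] (K →L[ℂ] K)) (Y : K →L[ℂ] K) :
    (J → J → ℂ) →ₗ[ℂ] (K →L[ℂ] K) where
  toFun a := ∑ j, ∑ l, a j l • (fibreProj M id j * Y * fibreProj M id l)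
  map_add' a b := by simp [add_smul, sum_add_distrib]
  map_smul' r a := by simp [mul_smul, smul_sum]

lemma map_eq_sum_fibreProj (M : (J → ℂ) →⋆ₐ[ℂ] (K →L[ℂ] K)) (g : J → ℂ) :
    M g = ∑ j, g j • fibreProj M id j := by
  classical
  simp only [fibreProj, ← map_smul, ← map_sum]
  congr 1
  ext l
  simp [Pi.single_apply]

lemma schurMul_mul (M : (J → ℂ) →⋆ₐ[ℂ] (K →L[ℂ] K)) (Y : K →L[ℂ] K) (g h : J → ℂ) :
    schurMul M Y (fun j l => g j * h l) = M g * Y * M h := by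
  rw [map_eq_sum_fibreProj M g, map_eq_sum_fibreProj M h, sum_mul, sum_mul]
  simp only [mul_sum, schurMul, LinearMap.coe_mk, AddHom.coe_mk]
  refine sum_congr rfl fun j _ => sum_congr rfl fun l _ => ?_
  simp [smul_smul, mul_comm (g j)]

lemma schurMul_one (M : (J → ℂ) →⋆ₐ[ℂ] (K →L[ℂ] K)) (Y : K →L[ℂ] K) :
    schurMul M Y (fun _ _ => 1) = Y := by
  simpa using! schurMul_mul M Y 1 1

open Classical in
/-- A block operator supported on finitely many diagonals. -/
lemma norm_schurMul_le [AddCommGroup ι] (M : (J → ℂ) →⋆ₐ[ℂ] (K →L[ℂ] K)) (Y : K →L[ℂ] K)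
    (q : J → ι) (R : ι → ι → Prop) (F : Finset ι) {b : ℝ} (hb : 0 ≤ b)
    (hF : ∀ s t, R s t → t - s ∈ F)
    (hY : ∀ s t, R s t → ‖fibreProj M q s * Y * fibreProj M q t‖ ≤ b) :
    ‖schurMul M Y (fun j l => if R (q j) (q l) then 1 else 0)‖ ≤ #F * b := by
  have e : (fun j l => if R (q j) (q l) then (1 : ℂ) else 0) = ∑ d ∈ F,
      ∑ s ∈ {s ∈ univ.image q | R s (s + d)}, (fun j l : J =>
        (q ⁻¹' {s}).indicator (1 : J → ℂ) j * (q ⁻¹' {s + d}).indicator (1 : J → ℂ) l) := by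
    ext j l
    simp only [Finset.sum_apply, Set.indicator_apply, Set.mem_preimage, Set.mem_singleton_iff,
      Pi.one_apply, ite_mul, one_mul, zero_mul, Finset.sum_ite_eq, mem_filter, mem_image,
      mem_univ, true_and]
    have : ∀ d, (q l = q j + d) ↔ d = q l - q j := fun d =>
      ⟨fun h => by rw [h]; abel, fun h => by rw [h]; abel⟩
    by_cases h : R (q j) (q l)
    · rw [if_pos h, Finset.sum_eq_single (q l - q j)]
      · simp [h]
      · intro d _ hd
        simp [this, hd]
      · exact fun h' => absurd (hF _ _ h) h'
    · rw [if_neg h, Finset.sum_eq_zero]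
      intro d _
      by_cases hd : q l = q j + d
      · simp [← hd, h]
      · simp [hd]
  rw [e, map_sum]
  refine (norm_sum_le_of_le (f := _) _ (fun d _ => ?_)).trans_eq (by rw [sum_const, nsmul_eq_mul])
  simp only [map_sum, schurMul_mul]
  refine norm_sum_fibreProj_le M q _ (add_left_injective d) (fun _ => Y) hb fun s hs => ?_
  exact hY _ _ (mem_filter.1 hs).2

omit [Fintype J] in
lemma fibreProj_mul_commutator_mul (M : (J → ℂ) →⋆ₐ[ℂ] (K →L[ℂ] K)) (W : K →L[ℂ] K)
    (q : J → ι) (s t : ι) (g : J → ℂ) (a b : ℂ) :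
    fibreProj M q s * (M g * W - W * M g) * fibreProj M q t =
      M ((q ⁻¹' {s}).indicator (fun j => g j - a)) * (fibreProj M q s * W * fibreProj M q t)
      - fibreProj M q s * W * fibreProj M q t * M ((q ⁻¹' {t}).indicator (fun j => g j - b))
      + (a - b) • (fibreProj M q s * W * fibreProj M q t) := by
  have h1 : ∀ (s : ι) (a : ℂ), fibreProj M q s * M g =
      M ((q ⁻¹' {s}).indicator (fun j => g j - a)) * fibreProj M q s + a • fibreProj M q s := by
    intro s a
    rw [fibreProj, ← map_mul, ← map_mul, ← map_smul, ← map_add]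
    congr 1
    ext j
    by_cases h : q j = s <;> simp [h]
  have h2 : ∀ (s : ι) (a : ℂ), M g * fibreProj M q s =
      fibreProj M q s * M ((q ⁻¹' {s}).indicator (fun j => g j - a)) + a • fibreProj M q s := by
    intro s a
    rw [fibreProj, ← map_mul, ← map_mul, ← map_smul, ← map_add]
    congr 1
    ext j
    by_cases h : q j = s <;> simp [h]
  calc fibreProj M q s * (M g * W - W * M g) * fibreProj M q t
      = fibreProj M q s * M g * W * fibreProj M q t
        - fibreProj M q s * W * (M g * fibreProj M q t) := by noncomm_ring
    _ = _ := by
      rw [h1 s a, h2 t b]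
      simp only [add_mul, mul_add, sub_smul, smul_mul_assoc, mul_smul_comm, mul_assoc]
      abel

lemma norm_map_indicator_le (M : (J → ℂ) →⋆ₐ[ℂ] (K →L[ℂ] K)) (S : Set J) {g : J → ℂ} {b : ℝ}
    (hb : 0 ≤ b) (hg : ∀ j ∈ S, ‖g j‖ ≤ b) : ‖M (S.indicator g)‖ ≤ b :=
  norm_map_le M hb fun j => by by_cases h : j ∈ S <;> simp [h, hb, hg]

lemma norm_fibreProj_mul_commutator_mul_le (M : (J → ℂ) →⋆ₐ[ℂ] (K →L[ℂ] K)) (W : K →L[ℂ] K)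
    (q : J → ι) (s t : ι) (g : J → ℂ) (a : ℂ) {b : ℝ} (hb : 0 ≤ b)
    (hs : ∀ j, q j = s → ‖g j - a‖ ≤ b) (ht : ∀ j, q j = t → ‖g j - a‖ ≤ b) :
    ‖fibreProj M q s * (M g * W - W * M g) * fibreProj M q t‖ ≤
      2 * b * ‖fibreProj M q s * W * fibreProj M q t‖ := by
  rw [fibreProj_mul_commutator_mul M W q s t g a a, sub_self, zero_smul, add_zero]
  have h1 := norm_map_indicator_le M (q ⁻¹' {s}) hb hs
  have h2 := norm_map_indicator_le M (q ⁻¹' {t}) hb ht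
  refine (norm_sub_le _ _).trans ?_
  refine (add_le_add (norm_mul_le _ _) (norm_mul_le _ _)).trans ?_
  nlinarith [norm_nonneg (fibreProj M q s * W * fibreProj M q t)]

lemma norm_fibreProj_mul_mul_le_of_separated (M : (J → ℂ) →⋆ₐ[ℂ] (K →L[ℂ] K)) (W : K →L[ℂ] K)
    (q : J → ι) (s t : ι) (g : J → ℂ) (a b : ℂ) {r : ℝ} (hr : 0 < r)
    (hs : ∀ j, q j = s → ‖g j - a‖ ≤ r) (ht : ∀ j, q j = t → ‖g j - b‖ ≤ r)
    (hab : 3 * r ≤ ‖a - b‖) :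
    ‖fibreProj M q s * W * fibreProj M q t‖ ≤ ‖M g * W - W * M g‖ / r := by
  have h0 := fibreProj_mul_commutator_mul M W q s t g a b
  have h1 := norm_map_indicator_le M (q ⁻¹' {s}) hr.le hs
  have h2 := norm_map_indicator_le M (q ⁻¹' {t}) hr.le ht
  have h3 := norm_fibreProj_mul_mul_le M q s t (M g * W - W * M g)
  set Y := fibreProj M q s * W * fibreProj M q t
  set A := M ((q ⁻¹' {s}).indicator (fun j => g j - a))
  set B := M ((q ⁻¹' {t}).indicator (fun j => g j - b))
  set Z := fibreProj M q s * (M g * W - W * M g) * fibreProj M q t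
  have h4 : (a - b) • Y = Z - A * Y + Y * B := by rw [h0]; abel
  have h5 : ‖a - b‖ * ‖Y‖ ≤ ‖Z‖ + ‖A‖ * ‖Y‖ + ‖Y‖ * ‖B‖ := by
    rw [← norm_smul, h4]
    refine (norm_add_le _ _).trans (add_le_add ((norm_sub_le _ _).trans ?_) (norm_mul_le _ _))
    gcongr
    exact norm_mul_le _ _
  rw [le_div_iff₀ hr]
  nlinarith [norm_nonneg Y]

/-- The index of the square of side `r` that contains `z`. -/
noncomputable def squareIndex (r : ℝ) (z : ℂ) : ℤ × ℤ := (⌊z.re / r⌋, ⌊z.im / r⌋)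

/-- The centre of the square of side `r` with index `s`. -/
noncomputable def squareCenter (r : ℝ) (s : ℤ × ℤ) : ℂ := ⟨r * (s.1 + 1 / 2), r * (s.2 + 1 / 2)⟩

/-- Two squares of the same size are near if their indices differ by at most two. -/
def SquaresNear (s t : ℤ × ℤ) : Prop := |t.1 - s.1| ≤ 2 ∧ |t.2 - s.2| ≤ 2

lemma abs_sub_floor_div_le {r : ℝ} (hr : 0 < r) (x : ℝ) :
    |x - r * (⌊x / r⌋ + 1 / 2)| ≤ r / 2 := by
  have h1 := Int.floor_le (x / r)
  have h2 := Int.lt_floor_add_one (x / r)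
  rw [le_div_iff₀ hr] at h1
  rw [div_lt_iff₀ hr] at h2
  rw [abs_le]
  constructor <;> nlinarith

lemma norm_sub_squareCenter_le {r : ℝ} (hr : 0 < r) (z : ℂ) :
    ‖z - squareCenter r (squareIndex r z)‖ ≤ r := by
  refine (Complex.norm_le_abs_re_add_abs_im _).trans ?_
  have h1 := abs_sub_floor_div_le hr z.re
  have h2 := abs_sub_floor_div_le hr z.im
  simp only [squareCenter, squareIndex, Complex.sub_re, Complex.sub_im]
  linarith

lemma norm_squareCenter_sub_le {r : ℝ} (hr : 0 < r) {s t : ℤ × ℤ}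
    (h1 : |t.1 - s.1| ≤ 5) (h2 : |t.2 - s.2| ≤ 5) :
    ‖squareCenter r t - squareCenter r s‖ ≤ 10 * r := by
  refine (Complex.norm_le_abs_re_add_abs_im _).trans ?_
  have e1 : r * ((t.1 : ℝ) + 1 / 2) - r * (s.1 + 1 / 2) = r * (t.1 - s.1) := by ring
  have e2 : r * ((t.2 : ℝ) + 1 / 2) - r * (s.2 + 1 / 2) = r * (t.2 - s.2) := by ring
  have h1' : |(t.1 : ℝ) - s.1| ≤ 5 := by exact_mod_cast h1
  have h2' : |(t.2 : ℝ) - s.2| ≤ 5 := by exact_mod_cast h2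
  simp only [squareCenter, Complex.sub_re, Complex.sub_im, e1, e2, abs_mul, abs_of_pos hr]
  nlinarith

lemma le_norm_squareCenter_sub {r : ℝ} (hr : 0 < r) {s t : ℤ × ℤ} (h : ¬ SquaresNear s t) :
    3 * r ≤ ‖squareCenter r s - squareCenter r t‖ := by
  rw [norm_sub_rev]
  have key : ∀ a b : ℤ, 2 < |b - a| → 3 * r ≤ |r * ((b : ℝ) + 1 / 2) - r * (a + 1 / 2)| := by
    intro a b hab
    have e : r * ((b : ℝ) + 1 / 2) - r * (a + 1 / 2) = r * (b - a) := by ring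
    have hab' : (3 : ℝ) ≤ |(b : ℝ) - a| := by exact_mod_cast hab
    rw [e, abs_mul, abs_of_pos hr]
    nlinarith
  rw [SquaresNear, not_and_or, not_le, not_le] at h
  rcases h with h | h
  · exact (key _ _ h).trans (Complex.abs_re_le_norm (squareCenter r t - squareCenter r s))
  · exact (key _ _ h).trans (Complex.abs_im_le_norm (squareCenter r t - squareCenter r s))

lemma squareIndex_two_mul (r : ℝ) (z : ℂ) :
    squareIndex (2 * r) z = ((squareIndex r z).1 / 2, (squareIndex r z).2 / 2) := by
  have key : ∀ x : ℝ, ⌊x / (2 * r)⌋ = ⌊x / r⌋ / 2 := fun x => by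
    rw [mul_comm, ← div_div]
    exact_mod_cast Int.floor_div_natCast (x / r) 2
  simp [squareIndex, key]

lemma SquaresNear.half {s t : ℤ × ℤ} (h : SquaresNear s t) :
    SquaresNear (s.1 / 2, s.2 / 2) (t.1 / 2, t.2 / 2) := by
  simp only [SquaresNear, abs_le] at *
  omega

lemma abs_sub_le_five_of_half {s t : ℤ × ℤ}
    (h : SquaresNear (s.1 / 2, s.2 / 2) (t.1 / 2, t.2 / 2)) :
    |t.1 - s.1| ≤ 5 ∧ |t.2 - s.2| ≤ 5 := by
  simp only [SquaresNear, abs_le] at *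
  omega

lemma squaresNear_squareIndex {r : ℝ} (hr : 0 < r) {z w : ℂ} (hz : ‖z‖ < r) (hw : ‖w‖ < r) :
    SquaresNear (squareIndex r z) (squareIndex r w) := by
  have key : ∀ x : ℝ, |x| < r → -1 ≤ ⌊x / r⌋ ∧ ⌊x / r⌋ < 1 := fun x hx => by
    rw [abs_lt] at hx
    constructor
    · rw [Int.le_floor, le_div_iff₀ hr]; push_cast; linarith
    · rw [Int.floor_lt, div_lt_iff₀ hr]; push_cast; linarith
  have h1 := key _ ((Complex.abs_re_le_norm z).trans_lt hz)
  have h2 := key _ ((Complex.abs_im_le_norm z).trans_lt hz)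
  have h3 := key _ ((Complex.abs_re_le_norm w).trans_lt hw)
  have h4 := key _ ((Complex.abs_im_le_norm w).trans_lt hw)
  simp only [SquaresNear, squareIndex, abs_le]
  omega

lemma mem_Icc_of_abs_le {s t : ℤ × ℤ} (h : |t.1 - s.1| ≤ 5 ∧ |t.2 - s.2| ≤ 5) :
    t - s ∈ Finset.Icc ((-5, -5) : ℤ × ℤ) (5, 5) := by
  simp only [abs_le] at h
  simp only [Finset.mem_Icc, Prod.le_def, Prod.fst_sub, Prod.snd_sub]
  omega

lemma geom_sum_two_rpow_le {x : ℝ} (hx0 : 0 < x) (hx1 : x ≤ 1) (n : ℕ) :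
    ∑ k ∈ range n, ((2 : ℝ)⁻¹ ^ x) ^ k ≤ 2 / x := by
  have h1 : (2 : ℝ)⁻¹ ^ x ≤ 1 - x / 2 := by
    have := rpow_one_add_le_one_add_mul_self (s := -(2 : ℝ)⁻¹) (by norm_num) hx0.le hx1
    norm_num at this ⊢
    linarith
  have h0 : 0 ≤ (2 : ℝ)⁻¹ ^ x := by positivity
  have h2 : (2 : ℝ)⁻¹ ^ x < 1 := by linarith
  have h3 := geom_sum_Ico_le_of_lt_one (m := 0) (n := n) h0 h2
  rw [← range_eq_Ico, pow_zero] at h3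
  refine h3.trans ?_
  rw [div_le_div_iff₀ (by linarith) hx0]
  linarith

open Classical in
/-- The part of the commutator estimate which concerns pairs of squares of one fixed size. -/
lemma norm_schurMul_commutator_le (M : (J → ℂ) →⋆ₐ[ℂ] (K →L[ℂ] K)) (W : K →L[ℂ] K) (c : J → ℂ)
    {f : ℂ → ℂ} {L α : ℝ} (hL : 0 ≤ L) (hα0 : 0 < α) (hα1 : α < 1)
    (hf : ∀ z w, ‖f z - f w‖ ≤ L * ‖z - w‖ ^ α) {r b : ℝ} (hr : 0 < r) (hb : 0 ≤ b)
    (R : ℤ × ℤ → ℤ × ℤ → Prop) (hR : ∀ s t, R s t → |t.1 - s.1| ≤ 5 ∧ |t.2 - s.2| ≤ 5)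
    (hW : ∀ s t, R s t → ‖fibreProj M (squareIndex r ∘ c) s * W *
      fibreProj M (squareIndex r ∘ c) t‖ ≤ b) :
    ‖schurMul M (M (f ∘ c) * W - W * M (f ∘ c))
      (fun j l => if R (squareIndex r (c j)) (squareIndex r (c l)) then 1 else 0)‖ ≤
      2662 * L * r ^ α * b := by
  have h11 : (11 : ℝ) ^ α ≤ 11 := by
    simpa using Real.rpow_le_rpow_of_exponent_le (x := 11) (by norm_num) hα1.le
  have hosc : ∀ z a : ℂ, ‖z - a‖ ≤ 11 * r → ‖f z - f a‖ ≤ 11 * L * r ^ α := fun z a h =>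
    calc ‖f z - f a‖ ≤ L * ‖z - a‖ ^ α := hf _ _
      _ ≤ L * (11 * r) ^ α := by gcongr
      _ = 11 ^ α * L * r ^ α := by rw [Real.mul_rpow (by norm_num) hr.le]; ring
      _ ≤ 11 * L * r ^ α := by gcongr
  refine (norm_schurMul_le M _ (squareIndex r ∘ c) R (Icc ((-5, -5) : ℤ × ℤ) (5, 5))
    (b := 22 * L * r ^ α * b) (by positivity) (fun s t h => mem_Icc_of_abs_le (hR s t h))
    fun s t h => ?_).trans_eq ?_
  · refine (norm_fibreProj_mul_commutator_mul_le M W _ s t (f ∘ c) (f (squareCenter r s))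
      (b := 11 * L * r ^ α) (by positivity) (fun j hj => ?_) fun l hl => ?_).trans ?_
    · refine hosc _ _ ?_
      rw [← hj]
      exact (norm_sub_squareCenter_le hr (c j)).trans (by linarith)
    · refine hosc _ _ ?_
      have h1 := norm_sub_squareCenter_le hr (c l)
      have h2 := norm_squareCenter_sub_le hr (hR s t h).1 (hR s t h).2
      rw [← hl] at h2
      exact (norm_sub_le_norm_sub_add_norm_sub _ _ _).trans (by simp at h2; linarith)
    · calc _ ≤ 2 * (11 * L * r ^ α) * b := by gcongr; exact hW s t h
        _ = _ := by ring
  · have : #(Icc ((-5, -5) : ℤ × ℤ) (5, 5)) = 121 := by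
      rw [← Finset.Icc_product_Icc, card_product]; simp
    rw [this]; push_cast; ring

open Classical in
/-- Commutators of a contraction with Hölder functions of a normal operator of finite spectrum. -/
theorem norm_commutator_comp_le (M : (J → ℂ) →⋆ₐ[ℂ] (K →L[ℂ] K)) (W : K →L[ℂ] K) (c : J → ℂ)
    {f : ℂ → ℂ} {L α δ : ℝ} (hL : 0 ≤ L) (hα0 : 0 < α) (hα1 : α < 1)
    (hf : ∀ z w, ‖f z - f w‖ ≤ L * ‖z - w‖ ^ α) (hδ : 0 < δ) (hW : ‖W‖ ≤ 1)
    (hcW : ‖M c * W - W * M c‖ ≤ δ) :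
    ‖M (f ∘ c) * W - W * M (f ∘ c)‖ ≤ 7986 * (1 - α)⁻¹ * L * δ ^ α := by
  set Z := M (f ∘ c) * W - W * M (f ∘ c) with hZ
  let near : ℕ → J → J → Prop := fun k j l =>
    SquaresNear (squareIndex (2 ^ k * δ) (c j)) (squareIndex (2 ^ k * δ) (c l))
  let ind : ℕ → J → J → ℂ := fun k j l => if near k j l then 1 else 0
  have hsucc : ∀ k z, squareIndex (2 ^ (k + 1) * δ) z = ((squareIndex (2 ^ k * δ) z).1 / 2,
      (squareIndex (2 ^ k * δ) z).2 / 2) := fun k z => by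
    rw [← squareIndex_two_mul]; congr 1; ring
  have hzero : ‖schurMul M Z (ind 0)‖ ≤ 2662 * L * δ ^ α := by
    have := norm_schurMul_commutator_le M W c hL hα0 hα1 hf hδ zero_le_one SquaresNear
      (fun s t h => ⟨h.1.trans (by norm_num), h.2.trans (by norm_num)⟩)
      (fun s t _ => (norm_fibreProj_mul_mul_le M _ s t W).trans hW)
    simpa [ind, near] using this
  have hdiff : ∀ k, ‖schurMul M Z (ind (k + 1) - ind k)‖ ≤
      2662 * L * δ ^ α * ((2 : ℝ)⁻¹ ^ (1 - α)) ^ k := by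
    intro k
    have hr : 0 < 2 ^ k * δ := by positivity
    obtain ⟨R, hR⟩ : ∃ R : ℤ × ℤ → ℤ × ℤ → Prop, ∀ s t, R s t ↔
        SquaresNear (s.1 / 2, s.2 / 2) (t.1 / 2, t.2 / 2) ∧ ¬ SquaresNear s t :=
      ⟨_, fun _ _ => Iff.rfl⟩
    have := norm_schurMul_commutator_le M W c hL hα0 hα1 hf hr
      (b := δ / (2 ^ k * δ)) (by positivity) R
      (fun s t h => abs_sub_le_five_of_half ((hR s t).1 h).1)
      (fun s t h => by
        refine (norm_fibreProj_mul_mul_le_of_separated M W _ s t c (squareCenter _ s)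
          (squareCenter _ t) hr ?_ ?_
          (le_norm_squareCenter_sub hr ((hR s t).1 h).2)).trans (by gcongr)
        · rintro j rfl
          exact norm_sub_squareCenter_le hr (c j)
        · rintro j rfl
          exact norm_sub_squareCenter_le hr (c j))
    have e : ind (k + 1) - ind k = fun j l => if
        R (squareIndex (2 ^ k * δ) (c j)) (squareIndex (2 ^ k * δ) (c l)) then 1 else 0 := by
      ext j l
      simp only [Pi.sub_apply, ind, near, hsucc]
      have := @SquaresNear.half (squareIndex (2 ^ k * δ) (c j)) (squareIndex (2 ^ k * δ) (c l))
      split_ifs <;> simp_all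
    rw [e]
    refine this.trans_eq ?_
    have e1 : ((2 : ℝ)⁻¹ ^ (1 - α)) ^ k = (2 ^ k) ^ α / 2 ^ k := by
      rw [← Real.rpow_natCast, ← Real.rpow_mul (by norm_num), Real.inv_rpow (by norm_num),
        ← Real.rpow_neg (by norm_num), ← Real.rpow_natCast 2 k, ← Real.rpow_mul (by norm_num),
        ← Real.rpow_sub (by norm_num)]
      congr 1; ring
    rw [Real.mul_rpow (by positivity) hδ.le, e1]
    field_simp
  obtain ⟨B, hB⟩ : ∃ B, ∀ j, ‖c j‖ ≤ B := ⟨‖c‖, norm_le_pi_norm c⟩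
  obtain ⟨n, hn⟩ : ∃ n : ℕ, B / δ < 2 ^ n := pow_unbounded_of_one_lt _ one_lt_two
  rw [div_lt_iff₀ hδ] at hn
  have hind : ind n = fun _ _ => 1 := by
    ext j l
    exact if_pos (squaresNear_squareIndex (by positivity) ((hB j).trans_lt hn)
      ((hB l).trans_lt hn))
  have htel : Z = schurMul M Z (ind 0) + ∑ k ∈ range n, schurMul M Z (ind (k + 1) - ind k) := by
    rw [← map_sum, sum_range_sub, ← map_add, add_sub_cancel, hind, schurMul_one]
  have hα : 0 < 1 - α := by linarith
  have hinv : 1 ≤ (1 - α)⁻¹ := (one_le_inv₀ hα).2 (by linarith)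
  have hP : 0 ≤ 2662 * L * δ ^ α := by positivity
  calc ‖Z‖ ≤ 2662 * L * δ ^ α + ∑ k ∈ range n, 2662 * L * δ ^ α * ((2 : ℝ)⁻¹ ^ (1 - α)) ^ k := by
        rw [htel]
        refine (norm_add_le _ _).trans (add_le_add hzero ?_)
        exact norm_sum_le_of_le _ fun k _ => hdiff k
    _ ≤ 2662 * L * δ ^ α * (1 - α)⁻¹ + 2662 * L * δ ^ α * (2 / (1 - α)) := by
        rw [← mul_sum]
        exact add_le_add (le_mul_of_one_le_right hP hinv)
          (mul_le_mul_of_nonneg_left (geom_sum_two_rpow_le hα (by linarith) n) hP)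
    _ = 7986 * (1 - α)⁻¹ * L * δ ^ α := by ring

end Discrete

lemma continuous_of_holder {f : ℂ → ℂ} {L α : ℝ} (hα : 0 < α)
    (hf : ∀ z w, ‖f z - f w‖ ≤ L * ‖z - w‖ ^ α) : Continuous f := by
  refine continuous_iff_continuousAt.2 fun w => tendsto_iff_norm_sub_tendsto_zero.2 ?_
  have h : Continuous fun z : ℂ => L * ‖z - w‖ ^ α := by
    have := (continuous_norm.comp (continuous_sub_right w)).rpow_const (p := α)
      fun _ => Or.inr hα.le
    exact this.const_mul L
  refine squeeze_zero (fun _ => norm_nonneg _) (fun z => hf z w) ?_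
  simpa [hα.ne'] using h.tendsto w

section Column

open ContinuousLinearMap Finset
open scoped InnerProduct

variable {J H : Type*} [Fintype J] [NormedAddCommGroup H] [InnerProductSpace ℂ H]

/-- The column operator `x ↦ (T j x)_j`. -/
noncomputable def columnOp (T : J → H →L[ℂ] H) : H →L[ℂ] PiLp 2 (fun _ : J => H) :=
  (PiLp.continuousLinearEquiv 2 ℂ (fun _ : J => H)).symm.toContinuousLinearMap ∘L
    ContinuousLinearMap.pi T

omit [Fintype J] in
@[simp]
lemma columnOp_apply (T : J → H →L[ℂ] H) (x : H) (j : J) : columnOp T x j = T j x := rfl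

omit [Fintype J] in
lemma columnOp_comp (T : J → H →L[ℂ] H) (A : H →L[ℂ] H) :
    columnOp T ∘L A = columnOp fun j => T j * A := rfl

lemma columnOp_sub (S T : J → H →L[ℂ] H) :
    columnOp S - columnOp T = columnOp fun j => S j - T j := rfl

variable [CompleteSpace H]

lemma adjoint_columnOp_comp (S T : J → H →L[ℂ] H) :
    (columnOp S)† ∘L columnOp T = ∑ j, star (S j) * T j := by
  refine ContinuousLinearMap.ext fun x => ext_inner_left ℂ fun y => ?_
  simp [adjoint_inner_right, PiLp.inner_apply, inner_sum, star_eq_adjoint]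

lemma norm_sq_columnOp (T : J → H →L[ℂ] H) :
    ‖columnOp T‖ ^ 2 = ‖∑ j, star (T j) * T j‖ := by
  rw [← adjoint_columnOp_comp, norm_adjoint_comp_self, sq]

/-- The diagonal operators on a finite power of `H`, as a star homomorphism. -/
noncomputable def diagOp (J H : Type*) [Fintype J] [NormedAddCommGroup H] [InnerProductSpace ℂ H]
    [CompleteSpace H] :
    (J → ℂ) →⋆ₐ[ℂ] (PiLp 2 (fun _ : J => H) →L[ℂ] PiLp 2 (fun _ : J => H)) where
  toFun g := (PiLp.continuousLinearEquiv 2 ℂ (fun _ : J => H)).symm.toContinuousLinearMap ∘L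
    ContinuousLinearMap.pi fun j => g j • PiLp.proj 2 (fun _ : J => H) j
  map_one' := by ext x j; simp
  map_mul' g h := by ext x j; simp [mul_smul]
  map_zero' := by ext x j; simp
  map_add' g h := by ext x j; simp [add_smul]
  commutes' r := by ext x j; simp
  map_star' g := by
    rw [star_eq_adjoint, eq_adjoint_iff]
    intro x y
    simp [PiLp.inner_apply, inner_smul_left, inner_smul_right]

lemma diagOp_comp_columnOp (g : J → ℂ) (T : J → H →L[ℂ] H) :
    diagOp J H g ∘L columnOp T = columnOp fun j => g j • T j := rfl

lemma sum_star_cfc_mul_cfc {N : H →L[ℂ] H} {g : J → ℂ → ℂ}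
    (hg : ∀ j, ContinuousOn (g j) (spectrum ℂ N)) :
    ∑ j, star (cfc (g j) N) * cfc (g j) N = cfc (fun z => ((∑ j, ‖g j z‖ ^ 2 : ℝ) : ℂ)) N := by
  have hs : ∀ j, ContinuousOn (fun z => star (g j z) * g j z) (spectrum ℂ N) :=
    fun j => (hg j).star.mul (hg j)
  have h : ∀ j, star (cfc (g j) N) * cfc (g j) N = cfc (fun z => star (g j z) * g j z) N :=
    fun j => by rw [cfc_mul _ _ N ((hg j).star) (hg j), cfc_star]
  simp only [h]
  rw [← cfc_sum_univ _ N hs]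
  congr 1
  ext z
  simp [Complex.conj_mul']

lemma norm_columnOp_cfc_le {N : H →L[ℂ] H} {g : J → ℂ → ℂ}
    (hg : ∀ j, ContinuousOn (g j) (spectrum ℂ N)) {b : ℝ} (hb : 0 ≤ b)
    (h : ∀ z ∈ spectrum ℂ N, ∑ j, ‖g j z‖ ^ 2 ≤ b ^ 2) :
    ‖columnOp fun j => cfc (g j) N‖ ≤ b := by
  refine (sq_le_sq₀ (opNorm_nonneg _) hb).1 ?_
  rw [norm_sq_columnOp, sum_star_cfc_mul_cfc hg]
  refine norm_cfc_le (sq_nonneg b) fun z hz => ?_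
  rw [Complex.norm_of_nonneg (by positivity)]
  exact h z hz

/-- `φ` is a square partition of unity on `S`, with `φ j` supported within `ε` of `c j`. -/
structure IsSquarePartition (φ : J → ℂ → ℂ) (c : J → ℂ) (S : Set ℂ) (ε : ℝ) : Prop where
  continuousOn : ∀ j, ContinuousOn (φ j) S
  sum_sq : ∀ z ∈ S, ∑ j, ‖φ j z‖ ^ 2 = 1
  dist_le : ∀ z ∈ S, ∀ j, φ j z ≠ 0 → ‖z - c j‖ ≤ ε

lemma exists_isSquarePartition {S : Set ℂ} (hS : IsCompact S) {ε : ℝ} (hε : 0 < ε) :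
    ∃ (t : Finset ℂ) (φ : t → ℂ → ℂ), IsSquarePartition φ (fun j => (j : ℂ)) S ε := by
  obtain ⟨t, -, ht, hcov⟩ := hS.finite_cover_balls hε
  lift t to Finset ℂ using ht
  let ρ : t → ℂ → ℝ := fun j z => max 0 (ε - ‖z - j‖)
  have hρ : ∀ j, Continuous (ρ j) := fun j => by fun_prop
  have hρ0 : ∀ j z, 0 ≤ ρ j z := fun j z => le_max_left _ _
  have hpos : ∀ z ∈ S, 0 < ∑ j, ρ j z := by
    intro z hz
    obtain ⟨a, ha, hza⟩ := Set.mem_iUnion₂.1 (hcov hz)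
    refine sum_pos' (fun j _ => hρ0 j z) ⟨⟨a, ha⟩, mem_univ _, lt_max_of_lt_right ?_⟩
    rw [Metric.mem_ball, dist_eq_norm] at hza
    exact sub_pos.2 hza
  refine ⟨t, fun j z => (√(ρ j z / ∑ i, ρ i z) : ℝ), fun j => ?_, fun z hz => ?_,
    fun z hz j hj => ?_⟩
  · refine Complex.continuous_ofReal.comp_continuousOn
      (Real.continuous_sqrt.comp_continuousOn ((hρ j).continuousOn.div ?_ fun z hz =>
        (hpos z hz).ne'))
    exact (continuous_finsetSum _ fun i _ => hρ i).continuousOn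
  · have : ∀ j, ‖((√(ρ j z / ∑ i, ρ i z) : ℝ) : ℂ)‖ ^ 2 = ρ j z / ∑ i, ρ i z := fun j => by
      rw [Complex.norm_of_nonneg (Real.sqrt_nonneg _),
        Real.sq_sqrt (div_nonneg (hρ0 j z) (hpos z hz).le)]
    simp only [this]
    rw [← sum_div, div_self (hpos z hz).ne']
  · by_contra! hlt
    have : ρ j z = 0 := max_eq_left (by linarith)
    simp [this] at hj

variable {φ : J → ℂ → ℂ} {c : J → ℂ} {ε : ℝ}

lemma IsSquarePartition.mono {S T : Set ℂ} (hφ : IsSquarePartition φ c S ε) (h : T ⊆ S) :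
    IsSquarePartition φ c T ε :=
  ⟨fun j => (hφ.continuousOn j).mono h, fun z hz => hφ.sum_sq z (h hz),
    fun z hz => hφ.dist_le z (h hz)⟩

lemma IsSquarePartition.adjoint_comp_self {N : H →L[ℂ] H} (hN : IsStarNormal N)
    (hφ : IsSquarePartition φ c (spectrum ℂ N) ε) :
    (columnOp fun j => cfc (φ j) N)† ∘L (columnOp fun j => cfc (φ j) N) = 1 := by
  rw [adjoint_columnOp_comp, sum_star_cfc_mul_cfc hφ.continuousOn, ← cfc_const_one ℂ N]
  exact cfc_congr fun z hz => by simp [hφ.sum_sq z hz]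

lemma IsSquarePartition.norm_columnOp_le {N : H →L[ℂ] H}
    (hφ : IsSquarePartition φ c (spectrum ℂ N) ε) :
    ‖columnOp fun j => cfc (φ j) N‖ ≤ 1 :=
  norm_columnOp_cfc_le hφ.continuousOn zero_le_one fun z hz => by simp [hφ.sum_sq z hz]

/-- The column operator of a square partition of unity almost intertwines `f(N)` with the diagonal
operator with entries `f (c j)`. -/
lemma IsSquarePartition.norm_diagOp_comp_sub_le {N : H →L[ℂ] H}
    (hφ : IsSquarePartition φ c (spectrum ℂ N) ε) {f : ℂ → ℂ} (hf : Continuous f) {b : ℝ}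
    (hb : 0 ≤ b) (hfb : ∀ z w, ‖z - w‖ ≤ ε → ‖f z - f w‖ ≤ b) :
    ‖diagOp J H (f ∘ c) ∘L (columnOp fun j => cfc (φ j) N) -
      (columnOp fun j => cfc (φ j) N) ∘L cfc f N‖ ≤ b := by
  have hc := hφ.continuousOn
  have hc₁ : ∀ j, ContinuousOn (fun z => f (c j) * φ j z) (spectrum ℂ N) :=
    fun j => (hc j).const_mul _
  have hc₂ : ∀ j, ContinuousOn (fun z => φ j z * f z) (spectrum ℂ N) :=
    fun j => (hc j).mul hf.continuousOn
  have e : diagOp J H (f ∘ c) ∘L (columnOp fun j => cfc (φ j) N) -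
      (columnOp fun j => cfc (φ j) N) ∘L cfc f N =
      columnOp fun j => cfc (fun z => f (c j) * φ j z - φ j z * f z) N := by
    rw [diagOp_comp_columnOp, columnOp_comp, columnOp_sub]
    congr 1
    ext1 j
    rw [cfc_sub _ _ N (hc₁ j) (hc₂ j),
      cfc_const_mul _ _ N (hc j), cfc_mul _ _ N (hc j) hf.continuousOn, Function.comp_apply]
  rw [e]
  refine norm_columnOp_cfc_le (fun j => (hc₁ j).sub (hc₂ j)) hb fun z hz => ?_
  rw [← mul_one (b ^ 2), ← hφ.sum_sq z hz, mul_sum]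
  refine sum_le_sum fun j _ => ?_
  rw [← mul_pow]
  gcongr
  by_cases h : φ j z = 0
  · simp [h]
  · rw [Pi.sub_apply, mul_comm (f (c j)), ← mul_sub, norm_mul, mul_comm]
    gcongr
    rw [norm_sub_rev]
    exact hfb _ _ (hφ.dist_le z hz j h)

lemma IsSquarePartition.norm_commutator_sub_le {N₁ N₂ : H →L[ℂ] H}
    (hφ₁ : IsSquarePartition φ c (spectrum ℂ N₁) ε)
    (hφ₂ : IsSquarePartition φ c (spectrum ℂ N₂) ε) {f : ℂ → ℂ} (hf : Continuous f) {b : ℝ}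
    (hb : 0 ≤ b) (hfb : ∀ z w, ‖z - w‖ ≤ ε → ‖f z - f w‖ ≤ b) :
    ‖diagOp J H (f ∘ c) * ((columnOp fun j => cfc (φ j) N₁) ∘L (columnOp fun j => cfc (φ j) N₂)†) -
      ((columnOp fun j => cfc (φ j) N₁) ∘L (columnOp fun j => cfc (φ j) N₂)†) * diagOp J H (f ∘ c) -
      (columnOp fun j => cfc (φ j) N₁) ∘L (cfc f N₁ - cfc f N₂) ∘L
        (columnOp fun j => cfc (φ j) N₂)†‖ ≤ 2 * b := by
  have h1 := hφ₁.norm_diagOp_comp_sub_le hf hb hfb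
  have h2 := hφ₂.norm_diagOp_comp_sub_le (f := fun z => star (f z)) hf.star hb
    (fun z w h => by rw [← star_sub, norm_star]; exact hfb z w h)
  have h3 := hφ₁.norm_columnOp_le
  have h4 := hφ₂.norm_columnOp_le
  rw [cfc_star] at h2
  have h5 : diagOp J H ((fun z => star (f z)) ∘ c) = (diagOp J H (f ∘ c))† := by
    rw [← star_eq_adjoint, ← map_star]; rfl
  rw [h5] at h2
  set V₁ := columnOp fun j => cfc (φ j) N₁
  set V₂ := columnOp fun j => cfc (φ j) N₂
  set D := diagOp J H (f ∘ c)
  have e : D * (V₁ ∘L V₂†) - (V₁ ∘L V₂†) * D - V₁ ∘L (cfc f N₁ - cfc f N₂) ∘L V₂† =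
      (D ∘L V₁ - V₁ ∘L cfc f N₁) ∘L V₂† - V₁ ∘L (D† ∘L V₂ - V₂ ∘L star (cfc f N₂))† := by
    rw [map_sub, adjoint_comp, adjoint_comp, adjoint_adjoint, star_eq_adjoint, adjoint_adjoint]
    ext1 x
    simp
    abel
  rw [e, two_mul]
  refine (norm_sub_le _ _).trans (add_le_add ?_ ?_)
  · refine (opNorm_comp_le _ _).trans ?_
    rw [LinearIsometryEquiv.norm_map]
    simpa using mul_le_mul h1 h4 (opNorm_nonneg _) hb
  · refine (opNorm_comp_le _ _).trans ?_
    rw [LinearIsometryEquiv.norm_map]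
    simpa using mul_le_mul h3 h2 (opNorm_nonneg _) zero_le_one

/-- The operator Hölder estimate with an explicit constant. -/
theorem norm_cfc_sub_cfc_le {f : ℂ → ℂ} {L α : ℝ} (hL : 0 ≤ L) (hα0 : 0 < α) (hα1 : α < 1)
    (hf : ∀ z w, ‖f z - f w‖ ≤ L * ‖z - w‖ ^ α) {N₁ N₂ : H →L[ℂ] H} (hN₁ : IsStarNormal N₁)
    (hN₂ : IsStarNormal N₂) :
    ‖cfc f N₁ - cfc f N₂‖ ≤ 24000 * (1 - α)⁻¹ * L * ‖N₁ - N₂‖ ^ α := by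
  rcases eq_or_ne N₁ N₂ with rfl | hne
  · simp [hα0.ne']
  set δ := ‖N₁ - N₂‖ with hδdef
  have hδ : 0 < δ := norm_pos_iff.2 (sub_ne_zero.2 hne)
  have hα : 0 < 1 - α := by linarith
  obtain ⟨t, φ, hφ⟩ := exists_isSquarePartition
    ((spectrum.isCompact N₁).union (spectrum.isCompact N₂)) hδ
  have hφ₁ : IsSquarePartition φ (fun j => (j : ℂ)) (spectrum ℂ N₁) δ :=
    hφ.mono Set.subset_union_left
  have hφ₂ : IsSquarePartition φ (fun j => (j : ℂ)) (spectrum ℂ N₂) δ :=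
    hφ.mono Set.subset_union_right
  have hid := hφ₁.norm_commutator_sub_le hφ₂ (f := id) continuous_id hδ.le
    (fun z w h => h)
  have hfc := hφ₁.norm_commutator_sub_le hφ₂ (continuous_of_holder hα0 hf)
    (b := L * δ ^ α) (by positivity) (fun z w h => (hf z w).trans (by gcongr))
  rw [cfc_id ℂ N₁, cfc_id ℂ N₂] at hid
  have hV₁ := hφ₁.norm_columnOp_le
  have hV₂ := hφ₂.norm_columnOp_le
  have hI₁ := hφ₁.adjoint_comp_self hN₁
  have hI₂ := hφ₂.adjoint_comp_self hN₂
  set V₁ := columnOp fun j => cfc (φ j) N₁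
  set V₂ := columnOp fun j => cfc (φ j) N₂
  have hV₁' : ‖V₁†‖ ≤ 1 := by rwa [LinearIsometryEquiv.norm_map]
  have hV₂' : ‖V₂†‖ ≤ 1 := by rwa [LinearIsometryEquiv.norm_map]
  have hW : ‖V₁ ∘L V₂†‖ ≤ 1 :=
    (opNorm_comp_le _ _).trans (mul_le_one₀ hV₁ (norm_nonneg _) hV₂')
  have hδ3 : ‖diagOp t H (id ∘ fun j => (j : ℂ)) * (V₁ ∘L V₂†) -
      (V₁ ∘L V₂†) * diagOp t H (id ∘ fun j => (j : ℂ))‖ ≤ 3 * δ := by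
    have h : ‖V₁ ∘L (N₁ - N₂) ∘L V₂†‖ ≤ 1 * (δ * 1) :=
      (opNorm_comp_le _ _).trans (mul_le_mul hV₁ ((opNorm_comp_le _ _).trans
        (mul_le_mul_of_nonneg_left hV₂' hδ.le)) (norm_nonneg _) zero_le_one)
    have := norm_le_norm_sub_add (diagOp t H (id ∘ fun j => (j : ℂ)) * (V₁ ∘L V₂†) -
      (V₁ ∘L V₂†) * diagOp t H (id ∘ fun j => (j : ℂ))) (V₁ ∘L (N₁ - N₂) ∘L V₂†)
    linarith
  have hmain := norm_commutator_comp_le (diagOp t H) (V₁ ∘L V₂†) (fun j => (j : ℂ)) hL hα0 hα1 hf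
    (mul_pos three_pos hδ) hW hδ3
  have hrec : cfc f N₁ - cfc f N₂ = V₁† ∘L (V₁ ∘L (cfc f N₁ - cfc f N₂) ∘L V₂†) ∘L V₂ := by
    calc _ = (V₁† ∘L V₁) ∘L (cfc f N₁ - cfc f N₂) ∘L (V₂† ∘L V₂) := by
          rw [hI₁, hI₂]; rfl
      _ = _ := rfl
  have hle : ‖cfc f N₁ - cfc f N₂‖ ≤ ‖V₁ ∘L (cfc f N₁ - cfc f N₂) ∘L V₂†‖ := by
    conv_lhs => rw [hrec]
    refine (opNorm_comp_le _ _).trans ((mul_le_of_le_one_left (norm_nonneg _) hV₁').trans ?_)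
    exact (opNorm_comp_le _ _).trans (mul_le_of_le_one_right (norm_nonneg _) hV₂)
  have hsplit := norm_le_norm_sub_add (V₁ ∘L (cfc f N₁ - cfc f N₂) ∘L V₂†)
    (diagOp t H (f ∘ fun j => (j : ℂ)) * (V₁ ∘L V₂†) -
      (V₁ ∘L V₂†) * diagOp t H (f ∘ fun j => (j : ℂ)))
  rw [norm_sub_rev] at hsplit
  have h3 : (3 * δ) ^ α ≤ 3 * δ ^ α := by
    rw [Real.mul_rpow (by norm_num) hδ.le]
    gcongr
    simpa using Real.rpow_le_rpow_of_exponent_le (x := 3) (by norm_num) hα1.le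
  have hinv : 1 ≤ (1 - α)⁻¹ := (one_le_inv₀ hα).2 (by linarith)
  have hP : 0 ≤ L * δ ^ α := by positivity
  calc ‖cfc f N₁ - cfc f N₂‖ ≤ 2 * (L * δ ^ α) + 7986 * (1 - α)⁻¹ * L * (3 * δ) ^ α := by
        linarith
    _ ≤ 2 * ((1 - α)⁻¹ * (L * δ ^ α)) + 7986 * (1 - α)⁻¹ * L * (3 * δ ^ α) := by
        have := le_mul_of_one_le_left hP hinv
        linarith [mul_le_mul_of_nonneg_left h3
          (show 0 ≤ 7986 * (1 - α)⁻¹ * L by positivity)]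
    _ = 23960 * ((1 - α)⁻¹ * (L * δ ^ α)) := by ring
    _ ≤ 24000 * ((1 - α)⁻¹ * (L * δ ^ α)) := by gcongr; norm_num
    _ = 24000 * (1 - α)⁻¹ * L * δ ^ α := by ring

end Column

/-- Hölder functions of order `α ∈ (0,1)` on `ℝ² = ℂ` are operator Hölder of order `α`
on normal operators: there is an absolute constant `c > 0` such that whenever
`M` is a Hölder bound for `f` (i.e. `|f(z₁) - f(z₂)| ≤ M |z₁ - z₂|^α` for all `z₁, z₂`,
so that `‖f‖_{Λ_α} ≤ M`), one has
`‖f(N₁) - f(N₂)‖ ≤ c (1-α)⁻¹ M ‖N₁ - N₂‖^α` for all bounded normal `N₁, N₂`. -/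
theorem holder_operator_holder :
    ∃ c : ℝ, 0 < c ∧
      ∀ (α : ℝ), 0 < α → α < 1 →
      ∀ (f : ℂ → ℂ) (M : ℝ), 0 ≤ M →
      (∀ z₁ z₂ : ℂ, ‖f z₁ - f z₂‖ ≤ M * ‖z₁ - z₂‖ ^ α) →
      ∀ (H : Type*) [NormedAddCommGroup H] [InnerProductSpace ℂ H] [CompleteSpace H]
        (N₁ N₂ : H →L[ℂ] H), IsStarNormal N₁ → IsStarNormal N₂ →
        ‖cfc f N₁ - cfc f N₂‖ ≤ c * (1 - α)⁻¹ * M * ‖N₁ - N₂‖ ^ α := by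
  refine ⟨24000, by norm_num, fun α hα0 hα1 f L hL hf H _ _ _ N₁ N₂ hN₁ hN₂ => ?_⟩
  exact norm_cfc_sub_cfc_le hL hα0 hα1 hf hN₁ hN₂
end

section
/- There exists an absolute constant c > 0 with the following property: for every modulus of continuity ω such that ω*(x) < ∞ for all x > 0, every f in the class Λ_ω(ℝ²), and all bounded normal operators N₁, N₂ on a complex Hilbert space H with N₁ ≠ N₂, one has ‖f(N₁) − f(N₂)‖ ≤ c · ‖f‖_{Λ_ω} · ω*(‖N₁ − N₂‖). -/
open MeasureTheory

/-- A modulus of continuity: a continuous nondecreasing subadditive function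
`ω : [0,∞) → [0,∞)` with `ω(0) = 0` and `ω(t) > 0` for `t > 0`. -/
structure IsModulusOfContinuity (ω : ℝ → ℝ) : Prop where
  continuousOn : ContinuousOn ω (Set.Ici 0)
  monotoneOn : MonotoneOn ω (Set.Ici 0)
  map_zero : ω 0 = 0
  pos : ∀ t : ℝ, 0 < t → 0 < ω t
  subadditive : ∀ s t : ℝ, 0 ≤ s → 0 ≤ t → ω (s + t) ≤ ω s + ω t

/-- `ω*(x) = x ∫_x^∞ ω(t) t⁻² dt`. -/
noncomputable def omegaStar (ω : ℝ → ℝ) (x : ℝ) : ℝ :=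
  x * ∫ t in Set.Ioi x, ω t / t ^ 2

/-- The rapidly decaying profile `(t² + 1)⁻²`. -/
noncomputable def bump (t : ℝ) : ℝ := ((t ^ 2 + 1) ^ 2)⁻¹

lemma bump_pos (t : ℝ) : 0 < bump t := by unfold bump; positivity

lemma continuous_bump : Continuous bump :=
  Continuous.inv₀ (by fun_prop) fun t => by positivity

lemma bump_le (t : ℝ) : bump t ≤ (t ^ 2 + 1)⁻¹ := by
  unfold bump
  gcongr
  nlinarith [sq_nonneg t]

lemma lintegral_enorm_apply_prod_sq_le {H : Type*} [NormedAddCommGroup H] [InnerProductSpace ℂ H]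
    {L : ℝ → H →L[ℂ] H} (hL : Continuous L) {C : ENNReal}
    (hC : ∀ y, ∫⁻ s, ‖L s y‖ₑ ^ 2 ≤ C * ‖y‖ₑ ^ 2) {F : ℝ → H} (hF : Continuous F) :
    ∫⁻ p : ℝ × ℝ, ‖L p.1 (F p.2)‖ₑ ^ 2 ≤ C * ∫⁻ t, ‖F t‖ₑ ^ 2 := by
  have hcont : Continuous fun p : ℝ × ℝ => ‖L p.1 (F p.2)‖ₑ ^ 2 :=
    (ENNReal.continuous_pow 2).comp (Continuous.enorm (by fun_prop))
  rw [Measure.volume_eq_prod, lintegral_prod_symm _ hcont.aemeasurable, ← lintegral_const_mul]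
  · exact lintegral_mono fun t => hC (F t)
  · exact ((ENNReal.continuous_pow 2).comp hF.enorm).measurable

lemma ofReal_sq_mul_enorm_sq {H : Type*} [NormedAddCommGroup H] {c : ℝ} (hc : 0 ≤ c) (y : H) :
    ENNReal.ofReal c ^ 2 * ‖y‖ₑ ^ 2 = ENNReal.ofReal ((c * ‖y‖) ^ 2) := by
  rw [← ofReal_norm, ← mul_pow, ← ENNReal.ofReal_mul hc, ENNReal.ofReal_pow (by positivity)]

lemma ContinuousLinearMap.opNorm_le_of_norm_inner_le {H : Type*} [NormedAddCommGroup H]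
    [InnerProductSpace ℂ H] {T : H →L[ℂ] H} {C : ℝ} (hC : 0 ≤ C)
    (h : ∀ u v, ‖inner ℂ v (T u)‖ ≤ C * ‖u‖ * ‖v‖) : ‖T‖ ≤ C := by
  refine T.opNorm_le_bound hC fun u => ?_
  have h1 := h u (T u)
  rw [inner_self_eq_norm_sq_to_K, norm_pow, RCLike.norm_ofReal, abs_norm] at h1
  rcases eq_or_lt_of_le (norm_nonneg (T u)) with h0 | h0
  · rw [← h0]; positivity
  · nlinarith

section Resolvent

variable {H : Type*} [NormedAddCommGroup H] [InnerProductSpace ℂ H] [CompleteSpace H]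

lemma resolventDenom_ne_zero (x t : ℝ) : ((x : ℂ) - t + Complex.I) ≠ 0 := by
  intro h
  simpa using congrArg Complex.im h

lemma normSq_resolventDenom (x t : ℝ) :
    ‖((x : ℂ) - t + Complex.I)‖ ^ 2 = (x - t) ^ 2 + 1 := by
  rw [← Complex.normSq_eq_norm_sq, Complex.normSq_apply]
  simp
  ring

lemma one_le_norm_resolventDenom (x t : ℝ) : 1 ≤ ‖((x : ℂ) - t + Complex.I)‖ := by
  have := normSq_resolventDenom x t
  nlinarith [sq_nonneg (x - t), norm_nonneg ((x : ℂ) - t + Complex.I)]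

/-- The resolvent `(X(N) - t + i)⁻¹` of the self-adjoint operator `X(N)`. -/
noncomputable def cfcResolvent (X : ℂ → ℝ) (N : H →L[ℂ] H) (t : ℝ) : H →L[ℂ] H :=
  cfc (fun z : ℂ => ((X z : ℂ) - t + Complex.I)⁻¹) N

variable {X Y : ℂ → ℝ} {N N₁ N₂ : H →L[ℂ] H}

lemma continuous_resolventFun (hX : Continuous X) (t : ℝ) :
    Continuous (fun z : ℂ => ((X z : ℂ) - t + Complex.I)⁻¹) :=
  Continuous.inv₀ (by fun_prop) fun z => resolventDenom_ne_zero _ _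

lemma norm_cfcResolvent_le (X : ℂ → ℝ) (N : H →L[ℂ] H) (t : ℝ) : ‖cfcResolvent X N t‖ ≤ 1 :=
  norm_cfc_le zero_le_one fun z _ => by
    rw [norm_inv]
    exact inv_le_one_of_one_le₀ (one_le_norm_resolventDenom _ _)

lemma continuous_cfcResolvent (hX : Continuous X) (N : H →L[ℂ] H) :
    Continuous (cfcResolvent X N) := by
  refine (LipschitzWith.of_dist_le_mul (K := 1) fun s t => ?_).continuous
  rw [dist_eq_norm, cfcResolvent, cfcResolvent, ← cfc_sub _ _ _
    (continuous_resolventFun hX s).continuousOn (continuous_resolventFun hX t).continuousOn]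
  refine norm_cfc_le (by positivity) fun z _ => ?_
  rw [inv_sub_inv (resolventDenom_ne_zero _ _) (resolventDenom_ne_zero _ _), norm_div, norm_mul]
  have h1 := one_le_norm_resolventDenom (X z) s
  have h2 := one_le_norm_resolventDenom (X z) t
  have h3 : ((X z : ℂ) - t + Complex.I - ((X z : ℂ) - s + Complex.I)) = ((s - t : ℝ) : ℂ) := by
    push_cast; ring
  rw [h3, Complex.norm_real, NNReal.coe_one, one_mul, Real.dist_eq, Real.norm_eq_abs]
  exact div_le_self (abs_nonneg _) (one_le_mul_of_one_le_of_one_le h1 h2)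

lemma cfcResolvent_sub_cfcResolvent (hX : Continuous X) (hN₁ : IsStarNormal N₁)
    (hN₂ : IsStarNormal N₂) (t : ℝ) :
    cfcResolvent X N₁ t - cfcResolvent X N₂ t = cfcResolvent X N₁ t *
      (cfc (fun z => (X z : ℂ)) N₂ - cfc (fun z => (X z : ℂ)) N₁) * cfcResolvent X N₂ t := by
  have hc : Continuous fun z => (X z : ℂ) := by fun_prop
  have hd : Continuous fun z => (X z : ℂ) - t + Complex.I := by fun_prop
  have hB : ∀ N : H →L[ℂ] H, IsStarNormal N → cfc (fun z => (X z : ℂ) - t + Complex.I) N =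
      cfc (fun z => (X z : ℂ)) N + algebraMap ℂ (H →L[ℂ] H) (-t + Complex.I) := by
    intro N hN
    rw [← cfc_add_const _ _ _ hc.continuousOn]
    simp only [sub_eq_add_neg, add_assoc]
  have h1 : cfcResolvent X N₁ t * cfc (fun z => (X z : ℂ) - t + Complex.I) N₁ = 1 := by
    rw [cfcResolvent, ← cfc_mul _ _ _ (continuous_resolventFun hX t).continuousOn hd.continuousOn,
      ← cfc_const_one ℂ N₁]
    exact cfc_congr fun z _ => inv_mul_cancel₀ (resolventDenom_ne_zero _ _)
  have h2 : cfc (fun z => (X z : ℂ) - t + Complex.I) N₂ * cfcResolvent X N₂ t = 1 := by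
    rw [cfcResolvent, ← cfc_mul _ _ _ hd.continuousOn (continuous_resolventFun hX t).continuousOn,
      ← cfc_const_one ℂ N₂]
    exact cfc_congr fun z _ => mul_inv_cancel₀ (resolventDenom_ne_zero _ _)
  have h3 : cfc (fun z => (X z : ℂ)) N₂ - cfc (fun z => (X z : ℂ)) N₁ =
      cfc (fun z => (X z : ℂ) - t + Complex.I) N₂ - cfc (fun z => (X z : ℂ) - t + Complex.I) N₁ := by
    rw [hB _ hN₁, hB _ hN₂]; abel
  rw [h3, mul_sub, sub_mul, h1, one_mul, mul_assoc, h2, mul_one]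

lemma one_add_sq_le_shift {B x w : ℝ} (hx : |x| ≤ B) :
    ((x - w) ^ 2 + 1)⁻¹ ≤ 2 * (1 + B ^ 2) * (1 + w ^ 2)⁻¹ := by
  have hxB : x ^ 2 ≤ B ^ 2 := sq_le_sq' (neg_le_of_abs_le hx) (le_of_abs_le hx)
  rw [← div_eq_mul_inv, inv_eq_one_div, div_le_div_iff₀ (by positivity) (by positivity)]
  nlinarith [sq_nonneg (x - w), sq_nonneg (2 * x - w), mul_nonneg (sq_nonneg B) (sq_nonneg (x - w))]

lemma exists_abs_le_on_spectrum (hX : Continuous X) (N : H →L[ℂ] H) :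
    ∃ B : ℝ, ∀ z ∈ spectrum ℂ N, |X z| ≤ B :=
  (spectrum.isCompact N).exists_bound_of_continuousOn hX.continuousOn

lemma star_cfcResolvent_mul_self (hX : Continuous X) (N : H →L[ℂ] H) (t : ℝ) :
    star (cfcResolvent X N t) * cfcResolvent X N t =
      cfc (fun z : ℂ => ((((X z - t) ^ 2 + 1)⁻¹ : ℝ) : ℂ)) N := by
  have hc := continuous_resolventFun hX t
  rw [cfcResolvent, ← cfc_star, ← cfc_mul _ _ _ hc.star.continuousOn hc.continuousOn]
  congr 1
  funext z
  rw [← normSq_resolventDenom, RCLike.star_def, Complex.conj_mul', norm_inv]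
  push_cast
  rw [inv_pow]

lemma lintegral_enorm_cfcResolvent_apply_sq (hX : Continuous X) (hN : IsStarNormal N) (y : H) :
    ∫⁻ t, ‖cfcResolvent X N t y‖ₑ ^ 2 = ENNReal.ofReal Real.pi * ‖y‖ₑ ^ 2 := by
  obtain ⟨B, hB⟩ := exists_abs_le_on_spectrum hX N
  have hcont : Continuous (Function.uncurry fun (t : ℝ) (z : ℂ) =>
      ((((X z - t) ^ 2 + 1)⁻¹ : ℝ) : ℂ)) := by
    refine Complex.continuous_ofReal.comp (Continuous.inv₀ (by fun_prop) fun p => ?_)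
    positivity
  have hbound : ∀ᵐ t : ℝ, ∀ z ∈ spectrum ℂ N,
      ‖((((X z - t) ^ 2 + 1)⁻¹ : ℝ) : ℂ)‖ ≤ 2 * (1 + B ^ 2) * (1 + t ^ 2)⁻¹ := by
    refine .of_forall fun t z hz => ?_
    rw [Complex.norm_real, Real.norm_of_nonneg (by positivity)]
    exact one_add_sq_le_shift (hB z hz)
  have hfin : HasFiniteIntegral fun t : ℝ => 2 * (1 + B ^ 2) * (1 + t ^ 2)⁻¹ :=
    (integrable_inv_one_add_sq.const_mul _).hasFiniteIntegral
  have hint := integrable_cfc _ _ N hcont.continuousOn hbound hfin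
  have hval := cfc_integral _ _ N hcont.continuousOn hbound hfin
  have hpi : ∀ x : ℝ, ∫ t : ℝ, ((x - t) ^ 2 + 1)⁻¹ = Real.pi := fun x => by
    rw [integral_sub_left_eq_self (fun t : ℝ => (t ^ 2 + 1)⁻¹) volume x]
    simpa only [add_comm] using integral_univ_inv_one_add_sq
  simp_rw [integral_complex_ofReal, hpi, ← star_cfcResolvent_mul_self hX] at hval
  simp_rw [← star_cfcResolvent_mul_self hX] at hint
  have hnorm : ∀ t, ‖cfcResolvent X N t y‖ ^ 2 =
      RCLike.re (inner ℂ y ((star (cfcResolvent X N t) * cfcResolvent X N t) y)) := fun t => by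
    rw [mul_apply_eq_comp, ContinuousLinearMap.star_eq_adjoint,
      ContinuousLinearMap.adjoint_inner_right, inner_self_eq_norm_sq]
  have hinty := hint.apply_continuousLinearMap y
  have hintn := (hinty.const_inner (𝕜 := ℂ) y).re
  have key : ∫ t, ‖cfcResolvent X N t y‖ ^ 2 = Real.pi * ‖y‖ ^ 2 := by
    simp_rw [hnorm]
    rw [integral_re (hinty.const_inner (𝕜 := ℂ) y), integral_inner hinty,
      ← ContinuousLinearMap.integral_apply hint, ← hval, cfc_const _ _ hN]
    simp only [Algebra.algebraMap_eq_smul_one, _root_.smul_apply, one_apply_eq_self,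
      inner_smul_right, RCLike.re_to_complex, Complex.re_ofReal_mul]
    congr 1
    exact inner_self_eq_norm_sq (𝕜 := ℂ) y
  have e1 : ∀ t, ‖cfcResolvent X N t y‖ₑ ^ 2 = ENNReal.ofReal (‖cfcResolvent X N t y‖ ^ 2) :=
    fun t => by rw [ENNReal.ofReal_pow (norm_nonneg _), ofReal_norm]
  simp_rw [e1]
  rw [← ofReal_integral_eq_lintegral_ofReal (by simpa only [hnorm] using hintn)
    (.of_forall fun t => by positivity), key, ENNReal.ofReal_mul Real.pi_pos.le,
    ENNReal.ofReal_pow (norm_nonneg _), ofReal_norm]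

lemma norm_cfcResolvent_apply_le (X : ℂ → ℝ) (N : H →L[ℂ] H) (t : ℝ) (y : H) :
    ‖cfcResolvent X N t y‖ ≤ ‖y‖ :=
  ((cfcResolvent X N t).le_of_opNorm_le (norm_cfcResolvent_le X N t) y).trans_eq (one_mul _)

lemma norm_cfcResolvent_sq_sub_apply_le (hX : Continuous X) (hN₁ : IsStarNormal N₁)
    (hN₂ : IsStarNormal N₂) (t : ℝ) (y : H) {ε : ℝ}
    (hε : ‖cfc (fun z => (X z : ℂ)) N₂ - cfc (fun z => (X z : ℂ)) N₁‖ ≤ ε) :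
    ‖(cfcResolvent X N₁ t ^ 2 - cfcResolvent X N₂ t ^ 2) y‖ ≤
      2 * ε * ‖cfcResolvent X N₂ t y‖ := by
  set D := cfc (fun z => (X z : ℂ)) N₂ - cfc (fun z => (X z : ℂ)) N₁
  set a := cfcResolvent X N₁ t
  set b := cfcResolvent X N₂ t
  have hab : a - b = a * D * b := cfcResolvent_sub_cfcResolvent hX hN₁ hN₂ t
  have hε0 : 0 ≤ ε := (norm_nonneg _).trans hε
  have ha : ∀ y, ‖a y‖ ≤ ‖y‖ := norm_cfcResolvent_apply_le X N₁ t
  have hb : ∀ y, ‖b y‖ ≤ ‖y‖ := norm_cfcResolvent_apply_le X N₂ t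
  have hD : ∀ y, ‖D y‖ ≤ ε * ‖y‖ := D.le_of_opNorm_le hε
  have hsplit : (a ^ 2 - b ^ 2) y = a (a (D (b y))) + a (D (b (b y))) := by
    have : a ^ 2 - b ^ 2 = a * (a - b) + (a - b) * b := by noncomm_ring
    rw [this, hab]
    simp
  calc _ ≤ ‖a (a (D (b y)))‖ + ‖a (D (b (b y)))‖ := hsplit ▸ norm_add_le _ _
    _ ≤ ε * ‖b y‖ + ε * ‖b y‖ := by
      gcongr
      · exact (ha _).trans ((ha _).trans (hD _))
      · exact (ha _).trans ((hD _).trans (by gcongr; exact hb _))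
    _ = _ := by ring

lemma lintegral_enorm_cfcResolvent_sq_sub_apply_sq_le (hX : Continuous X) (hN₁ : IsStarNormal N₁)
    (hN₂ : IsStarNormal N₂) (y : H) {ε : ℝ}
    (hε : ‖cfc (fun z => (X z : ℂ)) N₂ - cfc (fun z => (X z : ℂ)) N₁‖ ≤ ε) :
    ∫⁻ t, ‖(cfcResolvent X N₁ t ^ 2 - cfcResolvent X N₂ t ^ 2) y‖ₑ ^ 2 ≤
      ENNReal.ofReal (2 * ε) ^ 2 * (ENNReal.ofReal Real.pi * ‖y‖ₑ ^ 2) := by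
  have hε0 : 0 ≤ ε := (norm_nonneg _).trans hε
  rw [← lintegral_enorm_cfcResolvent_apply_sq hX hN₂, ← lintegral_const_mul']
  · refine lintegral_mono fun t => ?_
    dsimp only
    rw [← mul_pow]
    gcongr
    rw [← ofReal_norm, ← ofReal_norm, ← ENNReal.ofReal_mul (by positivity)]
    exact ENNReal.ofReal_le_ofReal (norm_cfcResolvent_sq_sub_apply_le hX hN₁ hN₂ t y hε)
  · exact ENNReal.pow_ne_top ENNReal.ofReal_ne_top

lemma lintegral_enorm_cfcResolvent_sq_apply_sq_le (hX : Continuous X) (hN : IsStarNormal N)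
    (y : H) : ∫⁻ t, ‖(cfcResolvent X N t ^ 2) y‖ₑ ^ 2 ≤ ENNReal.ofReal Real.pi * ‖y‖ₑ ^ 2 := by
  rw [← lintegral_enorm_cfcResolvent_apply_sq hX hN]
  refine lintegral_mono fun t => ?_
  dsimp only
  gcongr
  rw [enorm_le_iff_norm_le, pow_two, mul_apply_eq_comp]
  exact norm_cfcResolvent_apply_le X N t _

lemma lintegral_mul_le_ofReal_mul {α : Type*} [MeasurableSpace α] {μ : Measure α}
    {f g : α → ENNReal} (hf : AEMeasurable f μ) (hg : AEMeasurable g μ) {a b : ℝ} (ha : 0 ≤ a)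
    (hb : 0 ≤ b) (hfa : ∫⁻ x, f x ^ 2 ∂μ ≤ ENNReal.ofReal (a ^ 2))
    (hgb : ∫⁻ x, g x ^ 2 ∂μ ≤ ENNReal.ofReal (b ^ 2)) :
    ∫⁻ x, f x * g x ∂μ ≤ ENNReal.ofReal (a * b) := by
  have h := ENNReal.lintegral_mul_le_Lp_mul_Lq μ Real.HolderConjugate.two_two hf hg
  simp only [Pi.mul_apply, ENNReal.rpow_two] at h
  have hroot : ∀ {c : ℝ}, 0 ≤ c → ENNReal.ofReal (c ^ 2) ^ (1 / 2 : ℝ) = ENNReal.ofReal c := by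
    intro c hc
    rw [ENNReal.ofReal_rpow_of_nonneg (by positivity) (by norm_num), ← Real.sqrt_eq_rpow,
      Real.sqrt_sq hc]
  calc _ ≤ _ := h
    _ ≤ ENNReal.ofReal (a ^ 2) ^ (1 / 2 : ℝ) * ENNReal.ofReal (b ^ 2) ^ (1 / 2 : ℝ) := by gcongr
    _ = _ := by rw [hroot ha, hroot hb, ENNReal.ofReal_mul ha]

lemma ennreal_add_sq_le (a b : ENNReal) : (a + b) ^ 2 ≤ 4 * (a ^ 2 + b ^ 2) := by
  wlog h : a ≤ b generalizing a b
  · rw [add_comm a, add_comm (a ^ 2)]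
    exact this b a (le_of_not_ge h)
  calc (a + b) ^ 2 ≤ (b + b) ^ 2 := by gcongr
    _ = 4 * b ^ 2 := by ring
    _ ≤ _ := by gcongr; exact le_add_self

/-- The product of squared resolvents of `X(N)` and `Y(N)`. -/
noncomputable def cfcWindow (X Y : ℂ → ℝ) (N : H →L[ℂ] H) (p : ℝ × ℝ) : H →L[ℂ] H :=
  cfcResolvent X N p.1 ^ 2 * cfcResolvent Y N p.2 ^ 2

lemma continuous_cfcWindow (hX : Continuous X) (hY : Continuous Y) (N : H →L[ℂ] H) :
    Continuous (cfcWindow X Y N) :=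
  (((continuous_cfcResolvent hX N).comp continuous_fst).pow 2).mul
    (((continuous_cfcResolvent hY N).comp continuous_snd).pow 2)

lemma lintegral_enorm_cfcWindow_apply_sq_le (hX : Continuous X) (hY : Continuous Y)
    (hN : IsStarNormal N) (v : H) :
    ∫⁻ p, ‖cfcWindow X Y N p v‖ₑ ^ 2 ≤ ENNReal.ofReal ((Real.pi * ‖v‖) ^ 2) := by
  have ha := continuous_cfcResolvent hX N
  have hb := continuous_cfcResolvent hY N
  calc _ ≤ ENNReal.ofReal Real.pi * ∫⁻ t, ‖(cfcResolvent Y N t ^ 2) v‖ₑ ^ 2 :=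
        lintegral_enorm_apply_prod_sq_le (by fun_prop)
          (lintegral_enorm_cfcResolvent_sq_apply_sq_le hX hN) (by fun_prop)
    _ ≤ ENNReal.ofReal Real.pi * (ENNReal.ofReal Real.pi * ‖v‖ₑ ^ 2) := by
        gcongr
        exact lintegral_enorm_cfcResolvent_sq_apply_sq_le hY hN v
    _ = _ := by rw [← ofReal_sq_mul_enorm_sq Real.pi_pos.le, sq (ENNReal.ofReal _), mul_assoc]

lemma lintegral_enorm_cfcWindow_sub_apply_sq_le (hX : Continuous X) (hY : Continuous Y)
    (hN₁ : IsStarNormal N₁) (hN₂ : IsStarNormal N₂) (u : H) {ε : ℝ}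
    (hεX : ‖cfc (fun z => (X z : ℂ)) N₂ - cfc (fun z => (X z : ℂ)) N₁‖ ≤ ε)
    (hεY : ‖cfc (fun z => (Y z : ℂ)) N₂ - cfc (fun z => (Y z : ℂ)) N₁‖ ≤ ε) :
    ∫⁻ p, ‖(cfcWindow X Y N₁ p - cfcWindow X Y N₂ p) u‖ₑ ^ 2 ≤
      ENNReal.ofReal ((6 * Real.pi * ε * ‖u‖) ^ 2) := by
  have hε0 : 0 ≤ ε := (norm_nonneg _).trans hεX
  have ha₁ := continuous_cfcResolvent hX N₁
  have ha₂ := continuous_cfcResolvent hX N₂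
  have hb₁ := continuous_cfcResolvent hY N₁
  have hb₂ := continuous_cfcResolvent hY N₂
  set P := ENNReal.ofReal Real.pi with hP
  set E := ENNReal.ofReal (2 * ε) with hE
  let F : ℝ → H := fun t => (cfcResolvent Y N₁ t ^ 2 - cfcResolvent Y N₂ t ^ 2) u
  let G : ℝ → H := fun t => (cfcResolvent Y N₂ t ^ 2) u
  have hF : Continuous F := by fun_prop
  have hG : Continuous G := by fun_prop
  have h1 : ∫⁻ p : ℝ × ℝ, ‖(cfcResolvent X N₁ p.1 ^ 2) (F p.2)‖ₑ ^ 2 ≤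
      P * (E ^ 2 * (P * ‖u‖ₑ ^ 2)) :=
    (lintegral_enorm_apply_prod_sq_le (by fun_prop)
      (lintegral_enorm_cfcResolvent_sq_apply_sq_le hX hN₁) hF).trans (by
        gcongr
        exact lintegral_enorm_cfcResolvent_sq_sub_apply_sq_le hY hN₁ hN₂ u hεY)
  have h2 : ∫⁻ p : ℝ × ℝ, ‖(cfcResolvent X N₁ p.1 ^ 2 - cfcResolvent X N₂ p.1 ^ 2) (G p.2)‖ₑ ^ 2 ≤
      E ^ 2 * P * (P * ‖u‖ₑ ^ 2) := by
    have hL : Continuous fun s => cfcResolvent X N₁ s ^ 2 - cfcResolvent X N₂ s ^ 2 := by fun_prop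
    have hLC : ∀ y, ∫⁻ s, ‖(cfcResolvent X N₁ s ^ 2 - cfcResolvent X N₂ s ^ 2) y‖ₑ ^ 2 ≤
        E ^ 2 * P * ‖y‖ₑ ^ 2 := fun y => by
      rw [mul_assoc]
      exact lintegral_enorm_cfcResolvent_sq_sub_apply_sq_le hX hN₁ hN₂ y hεX
    refine (lintegral_enorm_apply_prod_sq_le hL hLC hG).trans ?_
    gcongr
    exact lintegral_enorm_cfcResolvent_sq_apply_sq_le hY hN₂ u
  have hsplit : ∀ p, (cfcWindow X Y N₁ p - cfcWindow X Y N₂ p) u =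
      (cfcResolvent X N₁ p.1 ^ 2) (F p.2) +
        (cfcResolvent X N₁ p.1 ^ 2 - cfcResolvent X N₂ p.1 ^ 2) (G p.2) := by
    intro p
    simp only [cfcWindow, F, G, _root_.sub_apply, mul_apply_eq_comp, map_sub]
    abel
  have hmeas : Measurable fun p : ℝ × ℝ => ‖(cfcResolvent X N₁ p.1 ^ 2) (F p.2)‖ₑ ^ 2 :=
    ((ENNReal.continuous_pow 2).comp (Continuous.enorm (by fun_prop))).measurable
  calc _ ≤ ∫⁻ p : ℝ × ℝ, 4 * (‖(cfcResolvent X N₁ p.1 ^ 2) (F p.2)‖ₑ ^ 2 +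
        ‖(cfcResolvent X N₁ p.1 ^ 2 - cfcResolvent X N₂ p.1 ^ 2) (G p.2)‖ₑ ^ 2) := by
        refine lintegral_mono fun p => ?_
        dsimp only
        rw [hsplit]
        refine le_trans ?_ (ennreal_add_sq_le _ _)
        gcongr
        exact enorm_add_le _ _
    _ ≤ 4 * (P * (E ^ 2 * (P * ‖u‖ₑ ^ 2)) + E ^ 2 * P * (P * ‖u‖ₑ ^ 2)) := by
        rw [lintegral_const_mul' _ _ (by norm_num), lintegral_add_left hmeas]
        gcongr
    _ = 8 * ((E * P) ^ 2 * ‖u‖ₑ ^ 2) := by ring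
    _ ≤ ENNReal.ofReal 9 * ((E * P) ^ 2 * ‖u‖ₑ ^ 2) := by
        gcongr
        norm_num
    _ = _ := by
        rw [hE, hP, ← ENNReal.ofReal_mul (by positivity), ofReal_sq_mul_enorm_sq (by positivity),
          ← ENNReal.ofReal_mul (by positivity)]
        congr 1
        ring

lemma star_cfcWindow_mul_self (hX : Continuous X) (hY : Continuous Y) (N : H →L[ℂ] H)
    (hN : IsStarNormal N) (p : ℝ × ℝ) : star (cfcWindow X Y N p) * cfcWindow X Y N p =
      cfc (fun z : ℂ => ((bump (X z - p.1) * bump (Y z - p.2) : ℝ) : ℂ)) N := by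
  have ha := continuous_resolventFun hX p.1
  have hb := continuous_resolventFun hY p.2
  have ha2 : Continuous fun z : ℂ => ((X z : ℂ) - p.1 + Complex.I)⁻¹ ^ 2 := ha.pow 2
  have hb2 : Continuous fun z : ℂ => ((Y z : ℂ) - p.2 + Complex.I)⁻¹ ^ 2 := hb.pow 2
  have hc : Continuous fun z : ℂ => ((X z : ℂ) - p.1 + Complex.I)⁻¹ ^ 2 *
      ((Y z : ℂ) - p.2 + Complex.I)⁻¹ ^ 2 := ha2.mul hb2
  rw [cfcWindow, cfcResolvent, cfcResolvent, ← cfc_pow _ _ _ ha.continuousOn,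
    ← cfc_pow _ _ _ hb.continuousOn, ← cfc_mul _ _ _ ha2.continuousOn
    hb2.continuousOn, ← cfc_star, ← cfc_mul _ _ _ hc.star.continuousOn hc.continuousOn]
  congr 1
  funext z
  rw [bump, bump, ← normSq_resolventDenom, ← normSq_resolventDenom, RCLike.star_def,
    Complex.conj_mul', norm_mul, norm_pow, norm_pow, norm_inv, norm_inv]
  push_cast
  rw [mul_pow, inv_pow, inv_pow, inv_pow, inv_pow]

lemma cfc_integral_bump_mul (hX : Continuous X) (hY : Continuous Y) (hN : IsStarNormal N)
    {G : ℝ × ℝ → ℂ} (hG : Continuous G) {K : ℝ} (hK : ∀ p, ‖G p‖ ≤ K) :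
    Integrable (fun p => G p • (star (cfcWindow X Y N p) * cfcWindow X Y N p)) ∧
    cfc (fun z => ∫ p : ℝ × ℝ, G p * ((bump (X z - p.1) * bump (Y z - p.2) : ℝ) : ℂ)) N =
      ∫ p, G p • (star (cfcWindow X Y N p) * cfcWindow X Y N p) := by
  obtain ⟨B, hB⟩ := exists_abs_le_on_spectrum hX N
  obtain ⟨B', hB'⟩ := exists_abs_le_on_spectrum hY N
  have hK0 : 0 ≤ K := (norm_nonneg _).trans (hK 0)
  have hbX : Continuous fun q : (ℝ × ℝ) × ℂ => bump (X q.2 - q.1.1) :=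
    continuous_bump.comp (by fun_prop)
  have hbY : Continuous fun q : (ℝ × ℝ) × ℂ => bump (Y q.2 - q.1.2) :=
    continuous_bump.comp (by fun_prop)
  have hb : ∀ p : ℝ × ℝ,
      Continuous fun z => ((bump (X z - p.1) * bump (Y z - p.2) : ℝ) : ℂ) := fun p =>
    Complex.continuous_ofReal.comp ((hbX.comp (Continuous.prodMk_right p)).mul
      (hbY.comp (Continuous.prodMk_right p)))
  have hcont : Continuous (Function.uncurry fun (p : ℝ × ℝ) (z : ℂ) =>
      G p * ((bump (X z - p.1) * bump (Y z - p.2) : ℝ) : ℂ)) :=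
    (hG.comp continuous_fst).mul (Complex.continuous_ofReal.comp (hbX.mul hbY))
  let bound : ℝ × ℝ → ℝ := fun p => K * (2 * (1 + B ^ 2) * (1 + p.1 ^ 2)⁻¹ *
    (2 * (1 + B' ^ 2) * (1 + p.2 ^ 2)⁻¹))
  have hbound : ∀ᵐ p : ℝ × ℝ, ∀ z ∈ spectrum ℂ N,
      ‖G p * ((bump (X z - p.1) * bump (Y z - p.2) : ℝ) : ℂ)‖ ≤ bound p := by
    refine .of_forall fun p z hz => ?_
    rw [norm_mul, Complex.norm_real, norm_mul, Real.norm_of_nonneg (bump_pos _).le,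
      Real.norm_of_nonneg (bump_pos _).le]
    have h1 := (bump_le _).trans (one_add_sq_le_shift (w := p.1) (hB z hz))
    have h2 := (bump_le _).trans (one_add_sq_le_shift (w := p.2) (hB' z hz))
    exact mul_le_mul (hK p) (mul_le_mul h1 h2 (bump_pos _).le (by positivity))
      (mul_nonneg (bump_pos _).le (bump_pos _).le) hK0
  have hfin : HasFiniteIntegral bound :=
    (((integrable_inv_one_add_sq.const_mul _).mul_prod
      (integrable_inv_one_add_sq.const_mul _)).const_mul K).hasFiniteIntegral
  have hrw : ∀ p, cfc (fun z => G p * ((bump (X z - p.1) * bump (Y z - p.2) : ℝ) : ℂ)) N =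
      G p • (star (cfcWindow X Y N p) * cfcWindow X Y N p) := fun p => by
    rw [star_cfcWindow_mul_self hX hY N hN, cfc_const_mul _ _ _ (hb p).continuousOn]
  have hint := integrable_cfc _ _ N hcont.continuousOn hbound hfin
  have hval := cfc_integral _ _ N hcont.continuousOn hbound hfin
  simp_rw [hrw] at hint hval
  exact ⟨hint, hval⟩

/-- Convolutions of bounded functions with the squared profile are operator Lipschitz, with a
bound that only depends on the supremum norm. -/
lemma norm_cfc_integral_bump_sub_le (hX : Continuous X) (hY : Continuous Y)
    (hN₁ : IsStarNormal N₁) (hN₂ : IsStarNormal N₂) {ε : ℝ}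
    (hεX : ‖cfc (fun z => (X z : ℂ)) N₂ - cfc (fun z => (X z : ℂ)) N₁‖ ≤ ε)
    (hεY : ‖cfc (fun z => (Y z : ℂ)) N₂ - cfc (fun z => (Y z : ℂ)) N₁‖ ≤ ε)
    {G : ℝ × ℝ → ℂ} (hG : Continuous G) {K : ℝ} (hK : ∀ p, ‖G p‖ ≤ K) :
    ‖cfc (fun z => ∫ p : ℝ × ℝ, G p * ((bump (X z - p.1) * bump (Y z - p.2) : ℝ) : ℂ)) N₁ -
      cfc (fun z => ∫ p : ℝ × ℝ, G p * ((bump (X z - p.1) * bump (Y z - p.2) : ℝ) : ℂ)) N₂‖ ≤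
      12 * Real.pi ^ 2 * K * ε := by
  have hε0 : 0 ≤ ε := (norm_nonneg _).trans hεX
  have hK0 : 0 ≤ K := (norm_nonneg _).trans (hK 0)
  obtain ⟨hI₁, hE₁⟩ := cfc_integral_bump_mul hX hY hN₁ hG hK
  obtain ⟨hI₂, hE₂⟩ := cfc_integral_bump_mul hX hY hN₂ hG hK
  rw [hE₁, hE₂, ← integral_sub hI₁ hI₂]
  have hI : Integrable fun p => G p • (star (cfcWindow X Y N₁ p) * cfcWindow X Y N₁ p) -
      G p • (star (cfcWindow X Y N₂ p) * cfcWindow X Y N₂ p) := hI₁.sub hI₂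
  have hc₁ := continuous_cfcWindow hX hY N₁
  have hc₂ := continuous_cfcWindow hX hY N₂
  set W₁ := cfcWindow X Y N₁
  set W₂ := cfcWindow X Y N₂
  refine ContinuousLinearMap.opNorm_le_of_norm_inner_le (by positivity) fun u v => ?_
  have hIu := hI.apply_continuousLinearMap u
  rw [ContinuousLinearMap.integral_apply hI, ← integral_inner hIu]
  have hpt : ∀ p, ‖inner ℂ v ((G p • (star (W₁ p) * W₁ p) - G p • (star (W₂ p) * W₂ p)) u)‖ₑ ≤
      ENNReal.ofReal K * (‖W₁ p v‖ₑ * ‖(W₁ p - W₂ p) u‖ₑ + ‖(W₁ p - W₂ p) v‖ₑ * ‖W₂ p u‖ₑ) := by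
    intro p
    have e : inner ℂ v ((G p • (star (W₁ p) * W₁ p) - G p • (star (W₂ p) * W₂ p)) u) =
        G p * (inner ℂ (W₁ p v) ((W₁ p - W₂ p) u) + inner ℂ ((W₁ p - W₂ p) v) (W₂ p u)) := by
      have : G p • (star (W₁ p) * W₁ p) - G p • (star (W₂ p) * W₂ p) =
          G p • (star (W₁ p) * (W₁ p - W₂ p) + star (W₁ p - W₂ p) * W₂ p) := by
        rw [← smul_sub, star_sub]
        noncomm_ring
      rw [this, _root_.smul_apply, inner_smul_right, _root_.add_apply, inner_add_right,
        mul_apply_eq_comp, mul_apply_eq_comp, ContinuousLinearMap.star_eq_adjoint,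
        ContinuousLinearMap.star_eq_adjoint, ContinuousLinearMap.adjoint_inner_right,
        ContinuousLinearMap.adjoint_inner_right]
    rw [e, ← ofReal_norm, ← ofReal_norm, ← ofReal_norm, ← ofReal_norm, ← ofReal_norm,
      ← ENNReal.ofReal_mul (by positivity), ← ENNReal.ofReal_mul (by positivity),
      ← ENNReal.ofReal_add (by positivity) (by positivity), ← ENNReal.ofReal_mul hK0, norm_mul]
    refine ENNReal.ofReal_le_ofReal (mul_le_mul (hK p) ?_ (norm_nonneg _) hK0)
    exact (norm_add_le _ _).trans (add_le_add (norm_inner_le_norm _ _) (norm_inner_le_norm _ _))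
  have hm : ∀ {L : ℝ × ℝ → H →L[ℂ] H} (y : H), Continuous L → Measurable fun p => ‖L p y‖ₑ :=
    fun y hL => (Continuous.enorm (by fun_prop)).measurable
  have hcs₁ := lintegral_mul_le_ofReal_mul (hm v hc₁).aemeasurable
    (hm u (hc₁.sub hc₂)).aemeasurable (by positivity) (by positivity)
    (lintegral_enorm_cfcWindow_apply_sq_le hX hY hN₁ v)
    (lintegral_enorm_cfcWindow_sub_apply_sq_le hX hY hN₁ hN₂ u hεX hεY)
  have hcs₂ := lintegral_mul_le_ofReal_mul (hm v (hc₁.sub hc₂)).aemeasurable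
    (hm u hc₂).aemeasurable (by positivity) (by positivity)
    (lintegral_enorm_cfcWindow_sub_apply_sq_le hX hY hN₁ hN₂ v hεX hεY)
    (lintegral_enorm_cfcWindow_apply_sq_le hX hY hN₂ u)
  rw [← ENNReal.ofReal_le_ofReal_iff (by positivity), ofReal_norm]
  calc _ ≤ _ := enorm_integral_le_lintegral_enorm _
    _ ≤ _ := lintegral_mono hpt
    _ = ENNReal.ofReal K * (∫⁻ p, ‖W₁ p v‖ₑ * ‖(W₁ p - W₂ p) u‖ₑ +
        ‖(W₁ p - W₂ p) v‖ₑ * ‖W₂ p u‖ₑ) := lintegral_const_mul' _ _ ENNReal.ofReal_ne_top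
    _ = ENNReal.ofReal K * ((∫⁻ p, ‖W₁ p v‖ₑ * ‖(W₁ p - W₂ p) u‖ₑ) +
        ∫⁻ p, ‖(W₁ p - W₂ p) v‖ₑ * ‖W₂ p u‖ₑ) := by
      congr 1
      exact lintegral_add_left ((hm v hc₁).mul (hm u (hc₁.sub hc₂))) _
    _ ≤ _ := mul_le_mul_right (add_le_add hcs₁ hcs₂) _
    _ = _ := by
      rw [← ENNReal.ofReal_add (by positivity) (by positivity), ← ENNReal.ofReal_mul hK0]
      congr 1
      ring

end Resolvent

lemma integrable_bump : Integrable bump := by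
  refine integrable_inv_one_add_sq.mono' continuous_bump.aestronglyMeasurable (.of_forall fun t => ?_)
  rw [Real.norm_of_nonneg (bump_pos t).le, add_comm]
  exact bump_le t

lemma integrable_abs_mul_bump : Integrable fun t => |t| * bump t := by
  refine integrable_inv_one_add_sq.mono' (continuous_abs.mul continuous_bump).aestronglyMeasurable
    (.of_forall fun t => ?_)
  rw [norm_mul, Real.norm_of_nonneg (bump_pos t).le, norm_abs_eq_norm, Real.norm_eq_abs, bump,
    ← div_eq_mul_inv, inv_eq_one_div, div_le_div_iff₀ (by positivity) (by positivity)]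
  nlinarith [sq_nonneg (|t| - 1), sq_abs t, abs_nonneg t, sq_nonneg t, sq_nonneg (t ^ 2)]

/-- The total mass of `bump`. -/
noncomputable def bumpMass : ℝ := ∫ t, bump t

lemma bumpMass_pos : 0 < bumpMass :=
  integral_pos_of_integrable_nonneg_nonzero (x := 0) continuous_bump integrable_bump
    (fun t => (bump_pos t).le) (bump_pos 0).ne'

/-- The normalised product kernel on the plane. -/
noncomputable def smoothingKernel (p : ℝ × ℝ) : ℝ := bump p.1 * bump p.2 / bumpMass ^ 2

lemma smoothingKernel_nonneg (p : ℝ × ℝ) : 0 ≤ smoothingKernel p :=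
  div_nonneg (mul_nonneg (bump_pos _).le (bump_pos _).le) (sq_nonneg _)

lemma continuous_smoothingKernel : Continuous smoothingKernel :=
  ((continuous_bump.comp continuous_fst).mul (continuous_bump.comp continuous_snd)).div_const _

lemma integrable_smoothingKernel : Integrable smoothingKernel :=
  (integrable_bump.mul_prod integrable_bump).div_const _

lemma integral_smoothingKernel : ∫ p, smoothingKernel p = 1 := by
  have h : ∫ p : ℝ × ℝ, bump p.1 * bump p.2 = bumpMass * bumpMass := integral_prod_mul bump bump
  simp_rw [smoothingKernel]
  rw [integral_div, h, ← sq, div_self (pow_pos bumpMass_pos 2).ne']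

lemma integrable_moment_smoothingKernel :
    Integrable fun p : ℝ × ℝ => (1 + (|p.1| + |p.2|)) * smoothingKernel p := by
  have h1 : Integrable fun p : ℝ × ℝ => |p.1| * bump p.1 * bump p.2 / bumpMass ^ 2 :=
    (integrable_abs_mul_bump.mul_prod integrable_bump).div_const _
  have h2 : Integrable fun p : ℝ × ℝ => bump p.1 * (|p.2| * bump p.2) / bumpMass ^ 2 :=
    (integrable_bump.mul_prod integrable_abs_mul_bump).div_const _
  refine (integrable_smoothingKernel.add (h1.add h2)).congr (.of_forall fun p => ?_)
  simp only [Pi.add_apply, smoothingKernel]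
  ring

/-- The first moment of the smoothing kernel. -/
noncomputable def kernelMoment : ℝ := ∫ p : ℝ × ℝ, (1 + (|p.1| + |p.2|)) * smoothingKernel p

lemma kernelMoment_nonneg : 0 ≤ kernelMoment :=
  integral_nonneg fun p => mul_nonneg (by positivity) (smoothingKernel_nonneg p)

/-- The complex number with the given real and imaginary parts. -/
noncomputable def pairToComplex (p : ℝ × ℝ) : ℂ := p.1 + p.2 * Complex.I

@[fun_prop]
lemma continuous_pairToComplex : Continuous pairToComplex := by
  unfold pairToComplex
  fun_prop

lemma norm_pairToComplex_le (p : ℝ × ℝ) : ‖pairToComplex p‖ ≤ |p.1| + |p.2| :=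
  (norm_add_le _ _).trans (by simp)

/-- Convolution of `f` with the smoothing kernel rescaled to width `R`. -/
noncomputable def smoothing (R : ℝ) (f : ℂ → ℂ) (z : ℂ) : ℂ :=
  ∫ p : ℝ × ℝ, (smoothingKernel p : ℂ) * f (z - R * pairToComplex p)

section Smoothing

variable {f g : ℂ → ℂ} {K L R S : ℝ}

lemma norm_smoothingKernel_mul_le (hK : ∀ z, ‖f z‖ ≤ K) (p : ℝ × ℝ) (z : ℂ) :
    ‖(smoothingKernel p : ℂ) * f z‖ ≤ smoothingKernel p * K := by
  rw [norm_mul, Complex.norm_real, Real.norm_of_nonneg (smoothingKernel_nonneg p)]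
  exact mul_le_mul_of_nonneg_left (hK z) (smoothingKernel_nonneg p)

lemma integrable_smoothing (hf : Continuous f) (hK : ∀ z, ‖f z‖ ≤ K) (R : ℝ) (z : ℂ) :
    Integrable fun p : ℝ × ℝ => (smoothingKernel p : ℂ) * f (z - R * pairToComplex p) := by
  refine (integrable_smoothingKernel.mul_const K).mono' ?_
    (.of_forall fun p => norm_smoothingKernel_mul_le hK p _)
  exact ((Complex.continuous_ofReal.comp continuous_smoothingKernel).mul
    (hf.comp (by fun_prop))).aestronglyMeasurable

lemma continuous_smoothing (hf : Continuous f) (hK : ∀ z, ‖f z‖ ≤ K) (R : ℝ) :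
    Continuous (smoothing R f) :=
  continuous_of_dominated (fun z => (integrable_smoothing hf hK R z).aestronglyMeasurable)
    (fun z => .of_forall fun p => norm_smoothingKernel_mul_le hK p _)
    (integrable_smoothingKernel.mul_const K)
    (.of_forall fun p => continuous_const.mul (hf.comp (by fun_prop)))

lemma norm_smoothing_le (hK : ∀ z, ‖f z‖ ≤ K) (R : ℝ) (z : ℂ) : ‖smoothing R f z‖ ≤ K := by
  refine (norm_integral_le_of_norm_le (integrable_smoothingKernel.mul_const K)
    (.of_forall fun p => norm_smoothingKernel_mul_le hK p _)).trans_eq ?_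
  rw [integral_mul_const, integral_smoothingKernel, one_mul]

lemma smoothing_sub (hf : Continuous f) (hK : ∀ z, ‖f z‖ ≤ K) (hg : Continuous g)
    (hL : ∀ z, ‖g z‖ ≤ L) (R : ℝ) (z : ℂ) :
    smoothing R (fun w => f w - g w) z = smoothing R f z - smoothing R g z := by
  simp_rw [smoothing, mul_sub]
  exact integral_sub (integrable_smoothing hf hK R z) (integrable_smoothing hg hL R z)

lemma smoothing_comm (hf : Continuous f) (hK : ∀ z, ‖f z‖ ≤ K) (R S : ℝ) (z : ℂ) :
    smoothing R (smoothing S f) z = smoothing S (smoothing R f) z := by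
  simp_rw [smoothing, ← integral_const_mul]
  rw [integral_integral_swap]
  · congr 1
    funext q
    congr 1
    funext p
    rw [sub_right_comm]
    ring
  · refine ((integrable_smoothingKernel.mul_prod integrable_smoothingKernel).mul_const K).mono'
      ?_ (.of_forall fun p => ?_)
    · refine Continuous.aestronglyMeasurable ?_
      have h := Complex.continuous_ofReal.comp continuous_smoothingKernel
      exact (h.comp continuous_fst).mul ((h.comp continuous_snd).mul (hf.comp (by fun_prop)))
    · simp only [Function.uncurry]
      rw [norm_mul, Complex.norm_real, Real.norm_of_nonneg (smoothingKernel_nonneg _), mul_assoc]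
      exact mul_le_mul_of_nonneg_left (norm_smoothingKernel_mul_le hK _ _)
        (smoothingKernel_nonneg _)

lemma smoothing_eq_integral_bump (hR : R ≠ 0) (f : ℂ → ℂ) (z : ℂ) :
    smoothing R f z = ∫ p : ℝ × ℝ, (f (R * pairToComplex p) / (bumpMass : ℂ) ^ 2) *
      ((bump (z.re / R - p.1) * bump (z.im / R - p.2) : ℝ) : ℂ) := by
  have hR' : (R : ℂ) ≠ 0 := by exact_mod_cast hR
  rw [smoothing, ← integral_sub_left_eq_self _ volume ((z.re / R, z.im / R) : ℝ × ℝ)]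
  congr 1
  funext p
  have harg : z - R * pairToComplex ((z.re / R, z.im / R) - p) = R * pairToComplex p := by
    simp only [pairToComplex, Prod.fst_sub, Prod.snd_sub]
    push_cast
    field_simp
    linear_combination -Complex.re_add_im z
  rw [harg, smoothingKernel]
  push_cast
  simp only [Prod.fst_sub, Prod.snd_sub]
  ring

lemma IsModulusOfContinuity.map_mul_le {ω : ℝ → ℝ} (hω : IsModulusOfContinuity ω) {R t : ℝ}
    (hR : 0 ≤ R) (ht : 0 ≤ t) : ω (R * t) ≤ (1 + t) * ω R := by
  have hnonneg : ∀ s, 0 ≤ s → 0 ≤ ω s := fun s hs =>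
    hω.map_zero.symm.le.trans (hω.monotoneOn Set.self_mem_Ici hs hs)
  have hnat : ∀ n : ℕ, ω (n * R) ≤ n * ω R := by
    intro n
    induction n with
    | zero => simp [hω.map_zero]
    | succ n ih =>
      push_cast
      rw [add_mul, add_mul, one_mul, one_mul]
      exact (hω.subadditive _ _ (by positivity) hR).trans (by gcongr)
  have hceil : t ≤ ⌈t⌉₊ := Nat.le_ceil t
  calc ω (R * t) ≤ ω (⌈t⌉₊ * R) := by
        refine hω.monotoneOn (Set.mem_Ici.2 (by positivity)) (Set.mem_Ici.2 (by positivity)) ?_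
        rw [mul_comm]
        gcongr
    _ ≤ ⌈t⌉₊ * ω R := hnat _
    _ ≤ _ := by
        refine mul_le_mul_of_nonneg_right ?_ (hnonneg R hR)
        linarith [Nat.ceil_lt_add_one ht]

lemma IsModulusOfContinuity.continuous_of_norm_sub_le {ω : ℝ → ℝ} (hω : IsModulusOfContinuity ω)
    {M : ℝ} (hf : ∀ z₁ z₂ : ℂ, ‖f z₁ - f z₂‖ ≤ M * ω ‖z₁ - z₂‖) : Continuous f := by
  rw [continuous_iff_continuousAt]
  intro z
  rw [ContinuousAt, tendsto_iff_norm_sub_tendsto_zero]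
  refine squeeze_zero (fun _ => norm_nonneg _) (fun w => hf w z) ?_
  have h1 : Filter.Tendsto (fun w => ‖w - z‖) (nhds z) (nhdsWithin 0 (Set.Ici 0)) := by
    refine tendsto_nhdsWithin_iff.2 ⟨?_, .of_forall fun w => norm_nonneg _⟩
    exact tendsto_iff_norm_sub_tendsto_zero.1 Filter.tendsto_id
  have h2 := (hω.continuousOn 0 Set.self_mem_Ici).tendsto.comp h1
  rw [hω.map_zero] at h2
  simpa using h2.const_mul M

lemma norm_sub_smoothing_le {ω : ℝ → ℝ} (hω : IsModulusOfContinuity ω) {M : ℝ} (hM : 0 ≤ M)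
    (hf : ∀ z₁ z₂ : ℂ, ‖f z₁ - f z₂‖ ≤ M * ω ‖z₁ - z₂‖) (hK : ∀ z, ‖f z‖ ≤ K)
    (hR : 0 < R) (z : ℂ) : ‖f z - smoothing R f z‖ ≤ kernelMoment * M * ω R := by
  have hfc := hω.continuous_of_norm_sub_le hf
  have hconst : f z = ∫ p : ℝ × ℝ, (smoothingKernel p : ℂ) * f z := by
    rw [integral_mul_const, integral_complex_ofReal, integral_smoothingKernel]
    simp
  have hint : Integrable fun p : ℝ × ℝ => (smoothingKernel p : ℂ) * f z :=
    integrable_smoothingKernel.ofReal.mul_const _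
  have hω0 := (hω.pos R hR).le
  rw [smoothing]
  nth_rewrite 1 [hconst]
  rw [← integral_sub hint (integrable_smoothing hfc hK R z)]
  refine (norm_integral_le_of_norm_le (integrable_moment_smoothingKernel.mul_const (M * ω R))
    (.of_forall fun p => ?_)).trans_eq ?_
  · rw [← mul_sub, norm_mul, Complex.norm_real, Real.norm_of_nonneg (smoothingKernel_nonneg p)]
    have h1 := hf z (z - R * pairToComplex p)
    rw [sub_sub_cancel, norm_mul, Complex.norm_real, Real.norm_of_nonneg hR.le] at h1
    have h2 := hω.map_mul_le hR.le (norm_nonneg (pairToComplex p))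
    have h3 : (1 + ‖pairToComplex p‖) * ω R ≤ (1 + (|p.1| + |p.2|)) * ω R := by
      gcongr
      exact norm_pairToComplex_le p
    calc _ ≤ smoothingKernel p * (M * ((1 + (|p.1| + |p.2|)) * ω R)) :=
          mul_le_mul_of_nonneg_left (h1.trans (mul_le_mul_of_nonneg_left (h2.trans h3) hM))
            (smoothingKernel_nonneg p)
      _ = _ := by ring
  · rw [integral_mul_const, ← kernelMoment, mul_assoc]

end Smoothing

section OmegaStar

variable {ω : ℝ → ℝ}

lemma IsModulusOfContinuity.div_add_integral_le (hω : IsModulusOfContinuity ω) {R : ℝ} (hR : 0 < R)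
    (hint : IntegrableOn (fun t => ω t / t ^ 2) (Set.Ioi R)) :
    ω R / (2 * R) + ∫ t in Set.Ioi (2 * R), ω t / t ^ 2 ≤ ∫ t in Set.Ioi R, ω t / t ^ 2 := by
  have hle : R ≤ 2 * R := by linarith
  have hI₁ := hint.mono_set (Set.Ioc_subset_Ioi_self : Set.Ioc R (2 * R) ⊆ Set.Ioi R)
  have hI₂ := hint.mono_set (Set.Ioi_subset_Ioi hle)
  rw [← Set.Ioc_union_Ioi_eq_Ioi hle, setIntegral_union
    (Set.Ioc_disjoint_Ioi le_rfl) measurableSet_Ioi hI₁ hI₂]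
  gcongr
  have hcont : ContinuousOn (fun t : ℝ => (t ^ 2)⁻¹) (Set.Icc R (2 * R)) :=
    ContinuousOn.inv₀ (by fun_prop) fun t ht => by have := hR.trans_le ht.1; positivity
  have hval : ∫ t in Set.Ioc R (2 * R), ω R * (t ^ 2)⁻¹ = ω R / (2 * R) := by
    rw [integral_const_mul, ← intervalIntegral.integral_of_le hle]
    have hderiv : ∀ t ∈ Set.uIcc R (2 * R), HasDerivAt (fun t : ℝ => -t⁻¹) (t ^ 2)⁻¹ t := by
      intro t ht
      rw [Set.uIcc_of_le hle] at ht
      exact (hasDerivAt_inv (hR.trans_le ht.1).ne').neg.congr_deriv (neg_neg _)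
    rw [intervalIntegral.integral_eq_sub_of_hasDerivAt hderiv
      (ContinuousOn.intervalIntegrable (by rwa [Set.uIcc_of_le hle]))]
    field_simp
    ring
  rw [← hval]
  refine setIntegral_mono_on ?_ hI₁ measurableSet_Ioc fun t ht => ?_
  · exact ((hcont.integrableOn_Icc).mono_set Set.Ioc_subset_Icc_self).const_mul _
  · rw [div_eq_mul_inv]
    refine mul_le_mul_of_nonneg_right ?_ (by positivity)
    exact hω.monotoneOn hR.le (hR.trans ht.1).le ht.1.le

lemma IsModulusOfContinuity.integral_nonneg (hω : IsModulusOfContinuity ω) {R : ℝ} (hR : 0 < R) :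
    0 ≤ ∫ t in Set.Ioi R, ω t / t ^ 2 :=
  setIntegral_nonneg measurableSet_Ioi fun t ht =>
    div_nonneg (hω.pos t (hR.trans ht)).le (sq_nonneg t)

end OmegaStar

section Operators

variable {H : Type*} [NormedAddCommGroup H] [InnerProductSpace ℂ H] [CompleteSpace H]
  {N N₁ N₂ : H →L[ℂ] H}

lemma cfc_re_div_eq (hN : IsStarNormal N) (R : ℝ) :
    cfc (fun z : ℂ => ((z.re / R : ℝ) : ℂ)) N = (1 / (2 * R) : ℂ) • (N + star N) := by
  have hfun : (fun z : ℂ => ((z.re / R : ℝ) : ℂ)) =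
      fun z => (1 / (2 * R) : ℂ) • (z + star z) := by
    funext z
    rw [RCLike.star_def, Complex.add_conj, smul_eq_mul]
    push_cast
    ring
  rw [hfun, cfc_smul _ _ _ (by fun_prop), cfc_add _ _ _ (by fun_prop) (by fun_prop),
    cfc_id' ℂ N, cfc_star_id (a := N)]

lemma cfc_im_div_eq (hN : IsStarNormal N) (R : ℝ) :
    cfc (fun z : ℂ => ((z.im / R : ℝ) : ℂ)) N =
      (-Complex.I / (2 * R) : ℂ) • (N - star N) := by
  have hfun : (fun z : ℂ => ((z.im / R : ℝ) : ℂ)) =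
      fun z => (-Complex.I / (2 * R) : ℂ) • (z - star z) := by
    funext z
    rw [RCLike.star_def, Complex.sub_conj, smul_eq_mul]
    push_cast
    linear_combination (z.im / R : ℂ) * Complex.I_sq
  rw [hfun, cfc_smul _ _ _ (by fun_prop), cfc_sub _ _ _ (by fun_prop) (by fun_prop),
    cfc_id' ℂ N, cfc_star_id (a := N)]

lemma norm_cfc_re_div_sub_le (hN₁ : IsStarNormal N₁) (hN₂ : IsStarNormal N₂) {R : ℝ}
    (hR : 0 < R) : ‖cfc (fun z : ℂ => ((z.re / R : ℝ) : ℂ)) N₂ -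
      cfc (fun z : ℂ => ((z.re / R : ℝ) : ℂ)) N₁‖ ≤ ‖N₁ - N₂‖ / R := by
  rw [cfc_re_div_eq hN₁, cfc_re_div_eq hN₂, ← smul_sub, norm_smul,
    show N₂ + star N₂ - (N₁ + star N₁) = (N₂ - N₁) + star (N₂ - N₁) by rw [star_sub]; abel]
  have h := norm_add_le (N₂ - N₁) (star (N₂ - N₁))
  rw [norm_star, norm_sub_rev N₂ N₁] at h
  have hc : ‖(1 / (2 * R) : ℂ)‖ = 1 / (2 * R) := by
    simp [abs_of_pos hR]
  rw [hc]
  calc _ ≤ 1 / (2 * R) * (‖N₁ - N₂‖ + ‖N₁ - N₂‖) := by gcongr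
    _ = _ := by field_simp; ring

lemma norm_cfc_im_div_sub_le (hN₁ : IsStarNormal N₁) (hN₂ : IsStarNormal N₂) {R : ℝ}
    (hR : 0 < R) : ‖cfc (fun z : ℂ => ((z.im / R : ℝ) : ℂ)) N₂ -
      cfc (fun z : ℂ => ((z.im / R : ℝ) : ℂ)) N₁‖ ≤ ‖N₁ - N₂‖ / R := by
  rw [cfc_im_div_eq hN₁, cfc_im_div_eq hN₂, ← smul_sub, norm_smul,
    show N₂ - star N₂ - (N₁ - star N₁) = (N₂ - N₁) - star (N₂ - N₁) by rw [star_sub]; abel]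
  have h := norm_sub_le (N₂ - N₁) (star (N₂ - N₁))
  rw [norm_star, norm_sub_rev N₂ N₁] at h
  have hc : ‖(-Complex.I / (2 * R) : ℂ)‖ = 1 / (2 * R) := by
    simp [abs_of_pos hR]
  rw [hc]
  calc _ ≤ 1 / (2 * R) * (‖N₁ - N₂‖ + ‖N₁ - N₂‖) := by gcongr
    _ = _ := by field_simp; ring

/-- The constant in the operator Lipschitz bound for smoothed functions. -/
noncomputable def smoothingConst : ℝ := 12 * Real.pi ^ 2 / bumpMass ^ 2

lemma smoothingConst_nonneg : 0 ≤ smoothingConst := by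
  unfold smoothingConst
  positivity

lemma norm_cfc_smoothing_sub_le (hN₁ : IsStarNormal N₁) (hN₂ : IsStarNormal N₂) {f : ℂ → ℂ}
    (hf : Continuous f) {K : ℝ} (hK : ∀ z, ‖f z‖ ≤ K) {R : ℝ} (hR : 0 < R) :
    ‖cfc (smoothing R f) N₁ - cfc (smoothing R f) N₂‖ ≤
      smoothingConst * K * (‖N₁ - N₂‖ / R) := by
  have hG : Continuous fun p : ℝ × ℝ => f (R * pairToComplex p) / (bumpMass : ℂ) ^ 2 :=
    (hf.comp (by fun_prop)).div_const _
  have hGK : ∀ p : ℝ × ℝ, ‖f (R * pairToComplex p) / (bumpMass : ℂ) ^ 2‖ ≤ K / bumpMass ^ 2 := by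
    intro p
    rw [norm_div, norm_pow, Complex.norm_real, Real.norm_of_nonneg bumpMass_pos.le]
    gcongr
    exact hK _
  have h := norm_cfc_integral_bump_sub_le (X := fun z => z.re / R) (Y := fun z => z.im / R)
    (by fun_prop) (by fun_prop) hN₁ hN₂ (norm_cfc_re_div_sub_le hN₁ hN₂ hR)
    (norm_cfc_im_div_sub_le hN₁ hN₂ hR) hG hGK
  rw [funext fun z => smoothing_eq_integral_bump hR.ne' f z]
  refine h.trans_eq ?_
  rw [smoothingConst]
  ring

section Modulus

variable {ω : ℝ → ℝ} {f : ℂ → ℂ} {M K : ℝ}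

lemma norm_cfc_smoothing_sub_le_smoothing_two_mul (hω : IsModulusOfContinuity ω) (hM : 0 ≤ M)
    (hf : ∀ z₁ z₂ : ℂ, ‖f z₁ - f z₂‖ ≤ M * ω ‖z₁ - z₂‖) (hK : ∀ z, ‖f z‖ ≤ K)
    (hN₁ : IsStarNormal N₁) (hN₂ : IsStarNormal N₂) {R : ℝ} (hR : 0 < R) :
    ‖cfc (smoothing R f) N₁ - cfc (smoothing R f) N₂‖ ≤
      ‖cfc (smoothing (2 * R) f) N₁ - cfc (smoothing (2 * R) f) N₂‖ +
        6 * smoothingConst * kernelMoment * M * ‖N₁ - N₂‖ * (ω R / (2 * R)) := by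
  have hfc := hω.continuous_of_norm_sub_le hf
  have hR2 : 0 < 2 * R := by positivity
  have hs := fun S => continuous_smoothing hfc hK S
  have hsK := fun S => norm_smoothing_le hK S
  have hE : ∀ S, Continuous fun w => f w - smoothing S f w := fun S => hfc.sub (hs S)
  have hEK := fun S (hS : 0 < S) => norm_sub_smoothing_le hω hM hf hK hS
  have hsE := fun S T (hT : 0 < T) => continuous_smoothing (hE T) (hEK T hT) S
  have hsplit : smoothing R f = fun z => smoothing (2 * R) f z +
      (smoothing R (fun w => f w - smoothing (2 * R) f w) z -
        smoothing (2 * R) (fun w => f w - smoothing R f w) z) := by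
    funext z
    rw [smoothing_sub hfc hK (hs _) (hsK _), smoothing_sub hfc hK (hs _) (hsK _),
      smoothing_comm hfc hK R (2 * R)]
    ring
  have hcfc : ∀ N : H →L[ℂ] H, cfc (smoothing R f) N = cfc (smoothing (2 * R) f) N +
      (cfc (smoothing R (fun w => f w - smoothing (2 * R) f w)) N -
        cfc (smoothing (2 * R) (fun w => f w - smoothing R f w)) N) := by
    intro N
    have h1 := (hsE R (2 * R) hR2)
    have h2 := (hsE (2 * R) R hR)
    rw [← cfc_sub _ _ _ h1.continuousOn h2.continuousOn,
      ← cfc_add N _ _ (hs _).continuousOn (h1.continuousOn.fun_sub h2.continuousOn), ← hsplit]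
  have h1 := norm_cfc_smoothing_sub_le hN₁ hN₂ (hE (2 * R)) (hEK _ hR2) hR
  have h2 := norm_cfc_smoothing_sub_le hN₁ hN₂ (hE R) (hEK _ hR) hR2
  have hω2 : ω (2 * R) ≤ 2 * ω R := by
    have := hω.subadditive R R hR.le hR.le
    rwa [← two_mul, ← two_mul] at this
  have hC := smoothingConst_nonneg
  have hk := kernelMoment_nonneg
  have hω0 := (hω.pos R hR).le
  have h1' : smoothingConst * (kernelMoment * M * ω (2 * R)) * (‖N₁ - N₂‖ / R) ≤
      smoothingConst * (kernelMoment * M * (2 * ω R)) * (‖N₁ - N₂‖ / R) := by gcongr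
  have hpos : 0 ≤ smoothingConst * kernelMoment * M * ‖N₁ - N₂‖ * (ω R / (2 * R)) := by positivity
  have e1 : smoothingConst * (kernelMoment * M * (2 * ω R)) * (‖N₁ - N₂‖ / R) =
      4 * (smoothingConst * kernelMoment * M * ‖N₁ - N₂‖ * (ω R / (2 * R))) := by
    field_simp; ring
  have e2 : smoothingConst * (kernelMoment * M * ω R) * (‖N₁ - N₂‖ / (2 * R)) =
      smoothingConst * kernelMoment * M * ‖N₁ - N₂‖ * (ω R / (2 * R)) := by
    field_simp
  rw [hcfc N₁, hcfc N₂, add_sub_add_comm, sub_sub_sub_comm]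
  refine (norm_add_le _ _).trans (add_le_add le_rfl ((norm_sub_le _ _).trans ?_))
  linarith

lemma norm_cfc_smoothing_sub_le_of_modulus (hω : IsModulusOfContinuity ω)
    (hint : ∀ x : ℝ, 0 < x → IntegrableOn (fun t => ω t / t ^ 2) (Set.Ioi x)) (hM : 0 ≤ M)
    (hf : ∀ z₁ z₂ : ℂ, ‖f z₁ - f z₂‖ ≤ M * ω ‖z₁ - z₂‖) (hK : ∀ z, ‖f z‖ ≤ K)
    (hN₁ : IsStarNormal N₁) (hN₂ : IsStarNormal N₂) {R : ℝ} (hR : 0 < R) :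
    ‖cfc (smoothing R f) N₁ - cfc (smoothing R f) N₂‖ ≤
      6 * smoothingConst * kernelMoment * M * ‖N₁ - N₂‖ * ∫ t in Set.Ioi R, ω t / t ^ 2 := by
  set A := 6 * smoothingConst * kernelMoment * M * ‖N₁ - N₂‖ with hA
  have hA0 : 0 ≤ A := by
    have := smoothingConst_nonneg
    have := kernelMoment_nonneg
    positivity
  have hstep : ∀ (n : ℕ) (R : ℝ), 0 < R → ‖cfc (smoothing R f) N₁ - cfc (smoothing R f) N₂‖ ≤
      smoothingConst * K * (‖N₁ - N₂‖ / R) * (1 / 2) ^ n +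
        A * ∫ t in Set.Ioi R, ω t / t ^ 2 := by
    intro n
    induction n with
    | zero =>
      intro R hR
      rw [pow_zero, mul_one]
      exact (norm_cfc_smoothing_sub_le hN₁ hN₂ (hω.continuous_of_norm_sub_le hf) hK hR).trans
        (le_add_of_nonneg_right (mul_nonneg hA0 (hω.integral_nonneg hR)))
    | succ n ih =>
      intro R hR
      have h1 := norm_cfc_smoothing_sub_le_smoothing_two_mul hω hM hf hK hN₁ hN₂ hR
      have h2 := ih (2 * R) (by positivity)
      have h3 := mul_le_mul_of_nonneg_left (hω.div_add_integral_le hR (hint R hR)) hA0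
      have e : smoothingConst * K * (‖N₁ - N₂‖ / R) * (1 / 2) ^ (n + 1) =
          smoothingConst * K * (‖N₁ - N₂‖ / (2 * R)) * (1 / 2) ^ n := by
        rw [pow_succ]
        field_simp
      rw [e]
      rw [mul_add] at h3
      linarith
  have hlim : Filter.Tendsto (fun n : ℕ => smoothingConst * K * (‖N₁ - N₂‖ / R) * (1 / 2) ^ n +
      A * ∫ t in Set.Ioi R, ω t / t ^ 2) Filter.atTop
      (nhds (A * ∫ t in Set.Ioi R, ω t / t ^ 2)) := by
    have h0 := tendsto_pow_atTop_nhds_zero_of_lt_one (r := (1 / 2 : ℝ)) (by norm_num) (by norm_num)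
    simpa using (h0.const_mul (smoothingConst * K * (‖N₁ - N₂‖ / R))).add_const
      (A * ∫ t in Set.Ioi R, ω t / t ^ 2)
  exact ge_of_tendsto' hlim fun n => hstep n R hR

lemma norm_cfc_sub_le_of_bounded (hω : IsModulusOfContinuity ω)
    (hint : ∀ x : ℝ, 0 < x → IntegrableOn (fun t => ω t / t ^ 2) (Set.Ioi x)) (hM : 0 ≤ M)
    (hf : ∀ z₁ z₂ : ℂ, ‖f z₁ - f z₂‖ ≤ M * ω ‖z₁ - z₂‖) (hK : ∀ z, ‖f z‖ ≤ K)
    (hN₁ : IsStarNormal N₁) (hN₂ : IsStarNormal N₂) (hne : N₁ ≠ N₂) :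
    ‖cfc f N₁ - cfc f N₂‖ ≤
      (4 * kernelMoment + 6 * smoothingConst * kernelMoment) * M * omegaStar ω ‖N₁ - N₂‖ := by
  have hfc := hω.continuous_of_norm_sub_le hf
  have hδ : 0 < ‖N₁ - N₂‖ := norm_pos_iff.2 (sub_ne_zero.2 hne)
  have h1 := norm_cfc_smoothing_sub_le_of_modulus hω hint hM hf hK hN₁ hN₂ hδ
  have h2 := hω.div_add_integral_le hδ (hint _ hδ)
  have h3 := hω.integral_nonneg (R := 2 * ‖N₁ - N₂‖) (by positivity)
  rw [omegaStar]
  set δ := ‖N₁ - N₂‖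
  set J := ∫ t in Set.Ioi δ, ω t / t ^ 2
  have hωδ : ω δ ≤ 2 * (δ * J) := by
    have h4 : ω δ / (2 * δ) ≤ J := by linarith
    rw [div_le_iff₀ (by positivity)] at h4
    linarith
  have hs := continuous_smoothing hfc hK δ
  have hk := kernelMoment_nonneg
  have hω0 := (hω.pos δ hδ).le
  have hE : ∀ N : H →L[ℂ] H, ‖cfc f N - cfc (smoothing δ f) N‖ ≤ kernelMoment * M * ω δ := by
    intro N
    rw [← cfc_sub _ _ _ hfc.continuousOn hs.continuousOn]
    exact norm_cfc_le (by positivity) fun z _ => norm_sub_smoothing_le hω hM hf hK hδ z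
  have hkM : kernelMoment * M * ω δ ≤ kernelMoment * M * (2 * (δ * J)) := by gcongr
  have hsplit : cfc f N₁ - cfc f N₂ = (cfc f N₁ - cfc (smoothing δ f) N₁) +
      (cfc (smoothing δ f) N₁ - cfc (smoothing δ f) N₂) -
        (cfc f N₂ - cfc (smoothing δ f) N₂) := by abel
  rw [hsplit]
  refine (norm_sub_le _ _).trans ?_
  have h5 := norm_add_le (cfc f N₁ - cfc (smoothing δ f) N₁)
    (cfc (smoothing δ f) N₁ - cfc (smoothing δ f) N₂)
  have h6 := hE N₁
  have h7 := hE N₂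
  linarith

end Modulus

/-- The nearest-point projection of the plane onto the square `[-ρ, ρ]²`. -/
noncomputable def clampSquare (ρ : ℝ) (z : ℂ) : ℂ :=
  ⟨max (-ρ) (min ρ z.re), max (-ρ) (min ρ z.im)⟩

lemma abs_clamp_sub_clamp_le (ρ x y : ℝ) :
    |max (-ρ) (min ρ x) - max (-ρ) (min ρ y)| ≤ |x - y| := by
  have h1 := abs_max_sub_max_le_max (-ρ) (min ρ x) (-ρ) (min ρ y)
  have h2 := abs_min_sub_min_le_max ρ x ρ y
  simp only [sub_self, abs_zero, abs_nonneg, sup_of_le_right] at h1 h2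
  exact h1.trans h2

lemma norm_clampSquare_sub_le (ρ : ℝ) (z w : ℂ) :
    ‖clampSquare ρ z - clampSquare ρ w‖ ≤ ‖z - w‖ := by
  rw [Complex.norm_eq_sqrt_sq_add_sq, Complex.norm_eq_sqrt_sq_add_sq]
  exact Real.sqrt_le_sqrt (add_le_add (sq_le_sq.2 (abs_clamp_sub_clamp_le ρ z.re w.re))
    (sq_le_sq.2 (abs_clamp_sub_clamp_le ρ z.im w.im)))

lemma clampSquare_eq_self {ρ : ℝ} {z : ℂ} (hz : ‖z‖ ≤ ρ) : clampSquare ρ z = z := by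
  have hre := abs_le.1 ((Complex.abs_re_le_norm z).trans hz)
  have him := abs_le.1 ((Complex.abs_im_le_norm z).trans hz)
  apply Complex.ext <;> simp [clampSquare, hre, him]

lemma norm_clampSquare_le {ρ : ℝ} (hρ : 0 ≤ ρ) (z : ℂ) : ‖clampSquare ρ z‖ ≤ ρ + ρ := by
  have h : ∀ x : ℝ, |max (-ρ) (min ρ x)| ≤ ρ := fun x =>
    abs_le.2 ⟨le_max_left _ _, max_le (by linarith) (min_le_left _ _)⟩
  exact (Complex.norm_le_abs_re_add_abs_im _).trans (add_le_add (h z.re) (h z.im))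

lemma norm_le_of_mem_spectrum {z : ℂ} (hz : z ∈ spectrum ℂ N) : ‖z‖ ≤ ‖N‖ := by
  cases subsingleton_or_nontrivial (H →L[ℂ] H)
  · simp [spectrum.of_subsingleton] at hz
  · exact spectrum.norm_le_norm_of_mem hz

end Operators

/-- There is an absolute constant `c > 0` such that for every modulus of continuity `ω`
with `ω*(x) < ∞` for all `x > 0` (i.e. `t ↦ ω(t)/t²` is integrable on `(x,∞)`), every
`f ∈ Λ_ω(ℝ²)` with `‖f‖_{Λ_ω} ≤ M` and all bounded normal operators `N₁ ≠ N₂`,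
`‖f(N₁) - f(N₂)‖ ≤ c M ω*(‖N₁ - N₂‖)`. -/
theorem modulus_of_continuity_operator_bound :
    ∃ c : ℝ, 0 < c ∧
      ∀ (ω : ℝ → ℝ), IsModulusOfContinuity ω →
      (∀ x : ℝ, 0 < x → IntegrableOn (fun t => ω t / t ^ 2) (Set.Ioi x)) →
      ∀ (f : ℂ → ℂ) (M : ℝ), 0 ≤ M →
      (∀ z₁ z₂ : ℂ, ‖f z₁ - f z₂‖ ≤ M * ω ‖z₁ - z₂‖) →
      ∀ (H : Type*) [NormedAddCommGroup H] [InnerProductSpace ℂ H] [CompleteSpace H]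
        (N₁ N₂ : H →L[ℂ] H), IsStarNormal N₁ → IsStarNormal N₂ → N₁ ≠ N₂ →
        ‖cfc f N₁ - cfc f N₂‖ ≤ c * M * omegaStar ω ‖N₁ - N₂‖ := by
  have hC := smoothingConst_nonneg
  have hk := kernelMoment_nonneg
  refine ⟨4 * kernelMoment + 6 * smoothingConst * kernelMoment + 1, by positivity, ?_⟩
  intro ω hω hint f M hM hf H _ _ _ N₁ N₂ hN₁ hN₂ hne
  have hδ : 0 < ‖N₁ - N₂‖ := norm_pos_iff.2 (sub_ne_zero.2 hne)
  set ρ := max ‖N₁‖ ‖N₂‖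
  have hρ : 0 ≤ ρ := (norm_nonneg N₁).trans (le_max_left _ _)
  have hg : ∀ z₁ z₂ : ℂ, ‖f (clampSquare ρ z₁) - f (clampSquare ρ z₂)‖ ≤ M * ω ‖z₁ - z₂‖ :=
    fun z₁ z₂ => (hf _ _).trans (mul_le_mul_of_nonneg_left (hω.monotoneOn (norm_nonneg _)
      (norm_nonneg _) (norm_clampSquare_sub_le ρ z₁ z₂)) hM)
  obtain ⟨K, hK⟩ := (isCompact_closedBall (0 : ℂ) (ρ + ρ)).exists_bound_of_continuousOn
    (hω.continuous_of_norm_sub_le hf).continuousOn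
  have hgK : ∀ z, ‖f (clampSquare ρ z)‖ ≤ K := fun z =>
    hK _ (mem_closedBall_zero_iff.2 (norm_clampSquare_le hρ z))
  have hcongr : ∀ N : H →L[ℂ] H, ‖N‖ ≤ ρ → cfc f N = cfc (fun z => f (clampSquare ρ z)) N :=
    fun N hN => cfc_congr fun z hz => by
      rw [clampSquare_eq_self ((norm_le_of_mem_spectrum hz).trans hN)]
  rw [hcongr N₁ (le_max_left _ _), hcongr N₂ (le_max_right _ _)]
  refine (norm_cfc_sub_le_of_bounded hω hint hM hg hgK hN₁ hN₂ hne).trans ?_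
  have hstar : 0 ≤ omegaStar ω ‖N₁ - N₂‖ := mul_nonneg hδ.le (hω.integral_nonneg hδ)
  refine mul_le_mul_of_nonneg_right (mul_le_mul_of_nonneg_right ?_ hM) hstar
  linarith
end
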